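/- arXiv:1806.02943 — 2 statements merged into one kernel-verified Lean document; each statement's English description precedes it below -/
import Mathlib

section
/- For all integers 1 ≤ k ≤ n, the Boolean product polynomial B_{n,k}(x_1,…,x_n) = ∏_{S ⊆ [n], |S| = k} (∑_{i ∈ S} x_i) is Schur-positive: there exist nonnegative integers κ_λ, indexed by partitions λ of binomial(n,k) with at most n parts, such that B_{n,k}(x_1,…,x_n) = ∑_λ κ_λ · s_λ(x_1,…,x_n). -/
open MvPolynomial

/-- Complete homogeneous symmetric polynomial with integer index: `0` for negative index. -/
noncomputable def hInt (n : ℕ) (m : ℤ) : MvPolynomial (Fin n) ℚ :=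
  if 0 ≤ m then hsymm (Fin n) ℚ m.toNat else 0

/-- Schur polynomial via the Jacobi–Trudi determinant. -/
noncomputable def schur (n : ℕ) (lam : Fin n → ℕ) : MvPolynomial (Fin n) ℚ :=
  (Matrix.of fun i j : Fin n => hInt n ((lam i : ℤ) - (i : ℤ) + (j : ℤ))).det

/-- The `(n,k)`-th Boolean product polynomial. -/
noncomputable def booleanProd (n k : ℕ) : MvPolynomial (Fin n) ℚ :=
  ∏ S ∈ (Finset.univ : Finset (Fin n)).powersetCard k, ∑ i ∈ S, X i

namespace BooleanSchur

section Characters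

open Representation

variable {G : Type} [Group G]

/-- `χ` is the character of an irreducible representation that embeds into `ρ`. -/
def IsConstituent {V : Type} [AddCommGroup V] [Module ℂ V] (ρ : Representation ℂ G V)
    (χ : G → ℂ) : Prop :=
  ∃ (W : Type) (_ : AddCommGroup W) (_ : Module ℂ W) (_ : FiniteDimensional ℂ W)
    (τ : Representation ℂ G W) (j : W →ₗ[ℂ] V), IsIrreducible τ ∧ Function.Injective j ∧
      (∀ g w, j (τ g w) = ρ g (j w)) ∧ τ.character = χ

theorem IsConstituent.of_injective {V V' : Type} [AddCommGroup V] [Module ℂ V]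
    [AddCommGroup V'] [Module ℂ V'] {ρ : Representation ℂ G V} {ρ' : Representation ℂ G V'}
    (i : V →ₗ[ℂ] V') (hi : Function.Injective i) (hiρ : ∀ g v, i (ρ g v) = ρ' g (i v))
    {χ : G → ℂ} (h : IsConstituent ρ χ) : IsConstituent ρ' χ := by
  obtain ⟨W, _, _, _, τ, j, hτ, hj, hjρ, hχ⟩ := h
  exact ⟨W, _, _, ‹_›, τ, i ∘ₗ j, hτ, hi.comp hj, fun g w => by simp [hjρ, hiρ], hχ⟩

theorem character_eq_add_of_isCompl {V : Type} [AddCommGroup V] [Module ℂ V]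
    [FiniteDimensional ℂ V] (ρ : Representation ℂ G V) {R S : Subrepresentation ρ}
    (h : IsCompl R S) :
    ρ.character = R.toRepresentation.character + S.toRepresentation.character := by
  have h' : IsCompl R.toSubmodule S.toSubmodule := by
    constructor
    · rw [disjoint_iff, ← Subrepresentation.toSubmodule_inf, h.inf_eq_bot]; rfl
    · rw [codisjoint_iff, ← Subrepresentation.toSubmodule_sup, h.sup_eq_top]; rfl
  let N : Bool → Submodule ℂ V := fun b => if b then R.toSubmodule else S.toSubmodule
  have hN : DirectSum.IsInternal N := by
    rw [DirectSum.isInternal_submodule_iff_isCompl N (i := true) (j := false) (by simp)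
      (by ext b; cases b <;> simp)]
    simpa [N] using h'
  ext g
  have hmaps : ∀ b, Set.MapsTo (ρ g) (N b) (N b) := by
    intro b
    cases b
    · exact S.apply_mem_toSubmodule g
    · exact R.apply_mem_toSubmodule g
  have := LinearMap.trace_eq_sum_trace_restrict hN hmaps
  rw [Fintype.sum_bool] at this
  exact this

variable [Fintype G]

theorem exists_constituents {V : Type} [AddCommGroup V] [Module ℂ V] [FiniteDimensional ℂ V]
    (ρ : Representation ℂ G V) :
    ∃ l : Multiset (G → ℂ), (∀ χ ∈ l, IsConstituent ρ χ) ∧ ρ.character = l.sum := by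
  induction hm : Module.finrank ℂ V using Nat.strong_induction_on generalizing V with
  | _ m ih =>
  subst hm
  by_cases hV : Subsingleton V
  · refine ⟨0, by simp, ?_⟩
    ext g
    simp [character, Subsingleton.elim (ρ g) 0]
  rw [not_subsingleton_iff_nontrivial] at hV
  by_cases hirr : IsIrreducible ρ
  · exact ⟨{ρ.character}, by
      simpa using ⟨V, _, _, ‹_›, ρ, LinearMap.id, hirr, Function.injective_id,
        fun _ _ => rfl, rfl⟩, by simp⟩
  have hnt : Nontrivial (Subrepresentation ρ) := by
    refine ⟨⊥, ⊤, fun h => ?_⟩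
    have h2 := congrArg Subrepresentation.toSubmodule h
    exact bot_ne_top (α := Submodule ℂ V) h2
  obtain ⟨R, hR0, hR1⟩ : ∃ R : Subrepresentation ρ, R ≠ ⊥ ∧ R ≠ ⊤ := by
    by_contra! hcon
    exact hirr ⟨fun R => or_iff_not_imp_left.2 (hcon R)⟩
  obtain ⟨S, hRS⟩ := exists_isCompl R
  have key : ∀ R : Subrepresentation ρ, R ≠ ⊤ →
      ∃ l : Multiset (G → ℂ), (∀ χ ∈ l, IsConstituent ρ χ) ∧
        R.toRepresentation.character = l.sum := by
    intro R hR
    have hlt : Module.finrank ℂ R.toSubmodule < Module.finrank ℂ V :=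
      Submodule.finrank_lt fun h => hR (Subrepresentation.toSubmodule_injective h)
    obtain ⟨l, hl, hsum⟩ := ih _ hlt R.toRepresentation rfl
    exact ⟨l, fun χ hχ => (hl χ hχ).of_injective R.toSubmodule.subtype
      R.toSubmodule.injective_subtype (fun _ _ => rfl), hsum⟩
  obtain ⟨l₁, h₁, e₁⟩ := key R hR1
  obtain ⟨l₂, h₂, e₂⟩ := key S fun h => hR0 (by simpa [h] using hRS.inf_eq_bot)
  refine ⟨l₁ + l₂, fun χ hχ => ?_, ?_⟩
  · rcases Multiset.mem_add.1 hχ with h | h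
    exacts [h₁ χ h, h₂ χ h]
  · rw [character_eq_add_of_isCompl ρ hRS, e₁, e₂, Multiset.sum_add]

/-- The bilinear pairing of functions on a finite group for which irreducible characters are
orthonormal. -/
noncomputable def charInner (φ : G → ℂ) : (G → ℂ) →ₗ[ℂ] ℂ :=
  (Nat.card G : ℂ)⁻¹ • ∑ g : G, φ g • LinearMap.proj g⁻¹

theorem charInner_apply (φ ψ : G → ℂ) :
    charInner φ ψ = (Nat.card G : ℂ)⁻¹ * ∑ g, φ g * ψ g⁻¹ := by
  simp [charInner]

theorem charInner_sum_left {α : Type*} (s : Finset α) (m : α → ℤ) (φ : α → G → ℂ) (ψ : G → ℂ) :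
    charInner (∑ i ∈ s, m i • φ i) ψ = ∑ i ∈ s, m i * charInner (φ i) ψ := by
  simp only [charInner_apply, Finset.sum_apply, Finset.sum_mul, Pi.smul_apply, Finset.mul_sum]
  rw [Finset.sum_comm]
  exact Finset.sum_congr rfl fun _ _ => Finset.sum_congr rfl fun _ _ => by
    rw [zsmul_eq_mul]; ring

open scoped Classical in
theorem IsConstituent.charInner_eq {V V' : Type} [AddCommGroup V] [Module ℂ V]
    [AddCommGroup V'] [Module ℂ V'] {ρ : Representation ℂ G V} {ρ' : Representation ℂ G V'}
    {χ χ' : G → ℂ} (h : IsConstituent ρ χ) (h' : IsConstituent ρ' χ') :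
    charInner χ χ' = if χ = χ' then 1 else 0 := by
  have : Invertible (Nat.card G : ℂ) := invertibleOfNonzero (by simp)
  obtain ⟨W, _, _, _, τ, j, hτ, hj, hjρ, rfl⟩ := h
  obtain ⟨W', _, _, _, τ', j', hτ', hj', hjρ', rfl⟩ := h'
  have h1 : charInner τ.character τ.character = 1 := by
    rw [charInner_apply, char_orthonormal, if_pos ⟨.refl τ⟩]
  split_ifs with heq
  · rw [← heq, h1]
  · rw [charInner_apply, char_orthonormal, if_neg]
    rintro ⟨e⟩
    exact heq (char_iso e).symm

/-- A virtual character of norm one that pairs positively with some character is irreducible. -/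
theorem isConstituent_of_charInner_self_eq_one {V V' : Type} [AddCommGroup V] [Module ℂ V]
    [AddCommGroup V'] [Module ℂ V'] [FiniteDimensional ℂ V']
    {ρ : Representation ℂ G V} {φ : G → ℂ}
    (hφ : φ ∈ Submodule.span ℤ {χ | IsConstituent ρ χ}) (hone : charInner φ φ = 1)
    (ρ' : Representation ℂ G V') (hpos : 0 < (charInner φ ρ'.character).re) :
    IsConstituent ρ φ := by
  classical
  obtain ⟨m, t, ht, -, rfl⟩ := Submodule.mem_span_iff_exists_finset_subset.1 hφ
  have hcoef : ∀ χ ∈ t, charInner (∑ a ∈ t, m a • a) χ = m χ := by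
    intro χ hχ
    rw [charInner_sum_left, Finset.sum_eq_single_of_mem χ hχ]
    · rw [(ht hχ).charInner_eq (ht hχ), if_pos rfl, mul_one]
    · intro b hb hbχ
      rw [(ht hb).charInner_eq (ht hχ), if_neg hbχ, mul_zero]
  have hsq : ∑ χ ∈ t, m χ * m χ = 1 := by
    have : charInner (∑ a ∈ t, m a • a) (∑ a ∈ t, m a • a) = ∑ χ ∈ t, (m χ : ℂ) * m χ := by
      conv_lhs => rw [map_sum]
      refine Finset.sum_congr rfl fun χ hχ => ?_
      rw [map_zsmul, hcoef χ hχ, zsmul_eq_mul]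
    rw [hone] at this
    exact_mod_cast this.symm
  obtain ⟨χ, hχ, hmχ⟩ : ∃ χ ∈ t, m χ ≠ 0 := by
    by_contra! hcon
    rw [Finset.sum_eq_zero fun χ hχ => by simp [hcon χ hχ]] at hsq
    exact zero_ne_one hsq
  have hrest : ∑ χ' ∈ t.erase χ, m χ' * m χ' = 0 := by
    have h1 := Finset.add_sum_erase t (fun χ => m χ * m χ) hχ
    have h2 : 0 ≤ ∑ χ' ∈ t.erase χ, m χ' * m χ' :=
      Finset.sum_nonneg fun _ _ => mul_self_nonneg _
    have h3 : 0 < m χ * m χ := mul_self_pos.2 hmχ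
    rw [hsq] at h1
    lia
  have hmsq : m χ * m χ = 1 := by
    have h1 := Finset.add_sum_erase t (fun χ => m χ * m χ) hχ
    linarith
  have hzero : ∀ χ' ∈ t.erase χ, m χ' = 0 := fun χ' h =>
    mul_self_eq_zero.1 ((Finset.sum_eq_zero_iff_of_nonneg fun _ _ => mul_self_nonneg _).1
      hrest χ' h)
  have hsum : ∑ a ∈ t, m a • a = m χ • χ := by
    rw [← Finset.add_sum_erase t _ hχ, Finset.sum_eq_zero, add_zero]
    intro a ha
    rw [hzero a ha, zero_smul]
  rw [hsum] at hpos ⊢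
  rcases mul_self_eq_one_iff.1 hmsq with h | h
  · rw [h, one_smul]
    exact ht hχ
  · exfalso
    obtain ⟨l, hl, hsum'⟩ := exists_constituents ρ'
    rw [h, hsum'] at hpos
    have hneg : charInner ((-1 : ℤ) • χ) l.sum = -(l.map fun χ' => charInner χ χ').sum := by
      rw [← map_multiset_sum, neg_one_smul, charInner_apply, charInner_apply]
      simp
    have hnn : 0 ≤ ((l.map fun χ' => charInner χ χ').sum).re := by
      change 0 ≤ Complex.reLm _
      rw [map_multiset_sum, Multiset.map_map]
      refine Multiset.sum_nonneg ?_
      simp only [Multiset.mem_map, Function.comp]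
      rintro _ ⟨χ', hχ', rfl⟩
      rw [(ht hχ).charInner_eq (hl χ' hχ')]
      change 0 ≤ (_ : ℂ).re
      split_ifs <;> simp
    rw [hneg, Complex.neg_re] at hpos
    linarith

open scoped ComplexOrder in
/-- If every eigenvalue of `∑ g, f g • ρ g` is nonnegative, then `f` pairs nonnegatively with
the irreducible characters that occur in `ρ`. -/
theorem IsConstituent.sum_mul_nonneg {V : Type} [AddCommGroup V] [Module ℂ V]
    {ρ : Representation ℂ G V} {χ : G → ℂ} (h : IsConstituent ρ χ) (f : G → ℂ)
    (hf : ∀ (c : ℂ) (v : V), v ≠ 0 → ∑ g, f g • ρ g v = c • v → 0 ≤ c) :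
    0 ≤ ∑ g, f g * χ g := by
  obtain ⟨W, _, _, _, τ, j, hτ, hj, hjρ, rfl⟩ := h
  let L : Module.End ℂ W := ∑ g, f g • τ g
  have htr : ∑ g, f g * τ.character g = LinearMap.trace ℂ W L := by
    simp [L, character]
  rw [htr, Module.End.trace_eq_sum_roots_charpoly_of_splits (IsAlgClosed.splits _)]
  refine Multiset.sum_nonneg fun c hc => ?_
  obtain ⟨w, hw⟩ := ((Module.End.hasEigenvalue_iff_isRoot_charpoly L c).2
    (Polynomial.isRoot_of_mem_roots hc)).exists_hasEigenvector
  refine hf c (j w) (fun h0 => hw.2 (hj (by simpa using h0))) ?_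
  have h1 : L w = c • w := hw.apply_eq_smul
  rw [← map_smul, ← h1]
  simp [L, hjρ]

end Characters

section Bialternant

variable {n : ℕ}

theorem hsymm_eq_sum_monomial (m : ℕ) :
    hsymm (Fin n) ℚ m = ∑ u ∈ Finset.univ.finsuppAntidiag m, monomial u 1 := by
  classical
  rw [hsymm]
  refine Finset.sum_bij (fun s _ => Multiset.toFinsupp s.1) ?_ ?_ ?_ ?_
  · intro s _
    rw [Finset.mem_finsuppAntidiag]
    refine ⟨?_, Finset.subset_univ _⟩
    refine (Finset.sum_congr rfl fun a _ => Multiset.toFinsupp_apply _ _).trans ?_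
    rw [Multiset.sum_count_eq_card (fun a _ => Finset.mem_univ a), s.2]
  · intro s _ t _ h
    exact Subtype.ext (Multiset.toFinsupp.injective h)
  · intro u hu
    rw [Finset.mem_finsuppAntidiag] at hu
    refine ⟨⟨Finsupp.toMultiset u, ?_⟩, Finset.mem_univ _, ?_⟩
    · rw [Finsupp.card_toMultiset, Finsupp.sum_fintype _ _ (fun _ => rfl)]
      exact hu.1
    · simp
  · intro s _
    rw [Finset.prod_multiset_map_count, monomial_eq, Finsupp.prod, Multiset.toFinsupp_support]
    simp

theorem mk_hsymm_eq_prod :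
    PowerSeries.mk (hsymm (Fin n) ℚ) =
      ∏ i, PowerSeries.mk fun m => (X i : MvPolynomial (Fin n) ℚ) ^ m := by
  classical
  ext1 m
  rw [PowerSeries.coeff_mk, PowerSeries.coeff_prod, hsymm_eq_sum_monomial]
  refine Finset.sum_congr rfl fun u _ => ?_
  simp [monomial_eq, Finsupp.prod_fintype]

/-- The polynomial `∏ (1 - xᵢ t)` over all `i ≠ k`. -/
noncomputable def elemPoly (k : Fin n) : Polynomial (MvPolynomial (Fin n) ℚ) :=
  ∏ i ∈ Finset.univ.erase k, (1 - Polynomial.C (X i) * Polynomial.X)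

theorem natDegree_elemPoly_lt (k : Fin n) : (elemPoly k).natDegree < n := by
  refine (Polynomial.natDegree_prod_le _ _).trans_lt ?_
  have : ∀ i ∈ Finset.univ.erase k,
      (1 - Polynomial.C (X i : MvPolynomial (Fin n) ℚ) * Polynomial.X).natDegree ≤ 1 := by
    intro i _
    compute_degree
  refine (Finset.sum_le_sum this).trans_lt ?_
  have := k.2
  simp
  omega

theorem one_sub_mul_mk_pow (i : Fin n) :
    ((1 - Polynomial.C (X i) * Polynomial.X : Polynomial (MvPolynomial (Fin n) ℚ)) :
      PowerSeries (MvPolynomial (Fin n) ℚ)) * PowerSeries.mk (fun m => X i ^ m) = 1 := by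
  ext1 m
  cases m with
  | zero => simp
  | succ m =>
    simp [sub_mul, mul_assoc, PowerSeries.coeff_succ_X_mul, pow_succ', PowerSeries.coeff_one]

theorem elemPoly_mul_mk_hsymm (k : Fin n) :
    (elemPoly k : PowerSeries (MvPolynomial (Fin n) ℚ)) * PowerSeries.mk (hsymm (Fin n) ℚ) =
      PowerSeries.mk fun m => (X k) ^ m := by
  rw [mk_hsymm_eq_prod, ← Finset.prod_erase_mul _ _ (Finset.mem_univ k), ← mul_assoc, elemPoly,
    ← Polynomial.coeToPowerSeries.ringHom_apply, map_prod, ← Finset.prod_mul_distrib]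
  simp only [Polynomial.coeToPowerSeries.ringHom_apply]
  rw [Finset.prod_eq_one (fun i _ => one_sub_mul_mk_pow i), one_mul]

theorem sum_elemPoly_coeff_mul_hInt (k : Fin n) (m : ℕ) :
    ∑ j : Fin n, hInt n ((m : ℤ) - j) * (elemPoly k).coeff j = X k ^ m := by
  have h := congrArg (PowerSeries.coeff m) (elemPoly_mul_mk_hsymm k)
  rw [PowerSeries.coeff_mk, PowerSeries.coeff_mul] at h
  rw [← h, Finset.Nat.sum_antidiagonal_eq_sum_range_succ_mk,
    Fin.sum_univ_eq_sum_range (fun j => hInt n ((m : ℤ) - j) * (elemPoly k).coeff j) n]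
  have e1 : ∑ j ∈ Finset.range n, hInt n ((m : ℤ) - j) * (elemPoly k).coeff j =
      ∑ j ∈ Finset.range (n + m + 1), hInt n ((m : ℤ) - j) * (elemPoly k).coeff j := by
    refine Finset.sum_subset (by simp; omega) fun j _ hj => ?_
    rw [Polynomial.coeff_eq_zero_of_natDegree_lt, mul_zero]
    have := natDegree_elemPoly_lt k
    simp at hj
    omega
  rw [e1]
  symm
  refine (Finset.sum_congr rfl fun j hj => ?_).trans
    (Finset.sum_subset (s₁ := Finset.range m.succ) (by simp) fun j _ hj => ?_)
  · rw [Finset.mem_range] at hj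
    rw [hInt, if_pos (by omega), Polynomial.coeff_coe, PowerSeries.coeff_mk, mul_comm]
    congr 2
    omega
  · rw [Finset.mem_range] at hj
    rw [hInt, if_neg (by omega), zero_mul]

/-- The staircase `(n - 1, …, 1, 0)`. -/
def staircase (n : ℕ) (i : Fin n) : ℕ := i.rev

/-- The alternant with exponents `α`. -/
noncomputable def alternant (α : Fin n → ℕ) : MvPolynomial (Fin n) ℚ :=
  (Matrix.of fun i j : Fin n => (X j : MvPolynomial (Fin n) ℚ) ^ α i).det

theorem schur_mul_det (lam : Fin n → ℕ) :
    schur n lam * (Matrix.of fun j k : Fin n => (elemPoly k).coeff (j.rev : ℕ)).det =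
      alternant (lam + staircase n) := by
  rw [schur, ← Matrix.det_mul, alternant]
  congr 1
  ext1 i k
  rw [Matrix.mul_apply, Matrix.of_apply, ← sum_elemPoly_coeff_mul_hInt,
    ← Equiv.sum_comp Fin.revPerm]
  refine Finset.sum_congr rfl fun j _ => ?_
  simp only [Matrix.of_apply, Fin.revPerm_apply, Fin.rev_rev]
  congr 2
  simp only [Pi.add_apply, staircase, Fin.val_rev]
  omega

theorem schur_zero : schur n 0 = 1 := by
  rw [schur, Matrix.det_of_isUpperTriangular]
  · simp [hInt]
  · intro i j hij
    have : (j : ℕ) < i := hij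
    rw [Matrix.of_apply, hInt, if_neg]
    simp
    omega

theorem schur_mul_alternant (lam : Fin n → ℕ) :
    schur n lam * alternant (staircase n) = alternant (lam + staircase n) := by
  rw [← schur_mul_det, ← zero_add (staircase n), ← schur_mul_det, schur_zero, one_mul]

end Bialternant

section Expansion

variable {n : ℕ}

theorem alternant_eq_sum (α : Fin n → ℕ) :
    alternant α = ∑ w : Equiv.Perm (Fin n),
      monomial (Finsupp.equivFunOnFinite.symm (α ∘ w)) ((Equiv.Perm.sign w : ℤ) : ℚ) := by
  rw [alternant, Matrix.det_apply']
  refine Finset.sum_congr rfl fun w _ => ?_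
  rw [monomial_eq, Finsupp.prod_fintype _ _ (fun _ => pow_zero _)]
  simp

theorem coeff_alternant (α v : Fin n → ℕ) :
    coeff (Finsupp.equivFunOnFinite.symm v) (alternant α) =
      ∑ w : Equiv.Perm (Fin n), if α ∘ w = v then ((Equiv.Perm.sign w : ℤ) : ℚ) else 0 := by
  simp [alternant_eq_sum, coeff_sum, coeff_monomial]

theorem perm_eq_one_of_strictMono {w : Equiv.Perm (Fin n)} (hw : StrictMono w) : w = 1 := by
  ext1 i
  exact DFunLike.congr_fun (Subsingleton.elim
    (StrictMono.orderIsoOfSurjective w hw w.surjective) (OrderIso.refl _)) i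

theorem coeff_alternant_of_strictAnti {α v : Fin n → ℕ} (hα : StrictAnti α) (hv : StrictAnti v) :
    coeff (Finsupp.equivFunOnFinite.symm v) (alternant α) = if α = v then 1 else 0 := by
  rw [coeff_alternant, Finset.sum_eq_single_of_mem 1 (Finset.mem_univ _)]
  · simp
  · intro w _ hw
    rw [if_neg]
    rintro rfl
    exact hw (perm_eq_one_of_strictMono fun i j hij => hα.lt_iff_gt.1 (hv hij))

theorem rename_alternant (α : Fin n → ℕ) (σ : Equiv.Perm (Fin n)) :
    rename σ (alternant α) = ((Equiv.Perm.sign σ : ℤ) : MvPolynomial (Fin n) ℚ) * alternant α := by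
  rw [alternant, AlgHom.map_det, ← Matrix.det_permute' σ]
  congr 1
  ext1 i j
  simp

theorem strictAnti_staircase : StrictAnti (staircase n) := by
  intro i j hij
  exact Fin.rev_lt_rev.2 hij

theorem isHomogeneous_alternant (α : Fin n → ℕ) : (alternant α).IsHomogeneous (∑ i, α i) := by
  rw [alternant_eq_sum]
  refine IsHomogeneous.sum _ _ _ fun w _ => isHomogeneous_monomial _ ?_
  rw [Finsupp.degree_eq_sum]
  exact Equiv.sum_comp w α

theorem alternant_staircase_ne_zero : alternant (staircase n) ≠ 0 := by
  intro h
  have := coeff_alternant_of_strictAnti (strictAnti_staircase (n := n)) strictAnti_staircase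
  simp [h] at this

/-- The coefficient of a Schur polynomial in the Schur expansion of a symmetric polynomial. -/
noncomputable def schurCoeff (lam : Fin n → ℕ) : MvPolynomial (Fin n) ℚ →ₗ[ℚ] ℚ :=
  lcoeff ℚ (Finsupp.equivFunOnFinite.symm (lam + staircase n)) ∘ₗ
    LinearMap.mulRight ℚ (alternant (staircase n))

theorem schurCoeff_apply (lam : Fin n → ℕ) (p : MvPolynomial (Fin n) ℚ) :
    schurCoeff lam p = coeff (Finsupp.equivFunOnFinite.symm (lam + staircase n))
      (p * alternant (staircase n)) := rfl

theorem strictAnti_add_staircase {lam : Fin n → ℕ} (h : Antitone lam) :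
    StrictAnti (lam + staircase n) :=
  h.add_strictAnti strictAnti_staircase

theorem schurCoeff_schur {lam mu : Fin n → ℕ} (hlam : Antitone lam) (hmu : Antitone mu) :
    schurCoeff mu (schur n lam) = if lam = mu then 1 else 0 := by
  rw [schurCoeff_apply, schur_mul_alternant,
    coeff_alternant_of_strictAnti (strictAnti_add_staircase hlam) (strictAnti_add_staircase hmu)]
  simp

theorem exists_antitone_add_staircase {v : Fin n → ℕ} (hv : StrictAnti v) :
    ∃ lam : Fin n → ℕ, Antitone lam ∧ v = lam + staircase n := by
  have key : ∀ i j : Fin n, i ≤ j → v j + (j - i) ≤ v i := by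
    intro i j hij
    obtain ⟨m, hm⟩ : ∃ m : ℕ, (j : ℕ) = i + m := ⟨j - i, by have : (i : ℕ) ≤ j := hij; omega⟩
    induction m generalizing j with
    | zero =>
      have : j = i := Fin.ext (by omega)
      subst this
      simp
    | succ m ih =>
      have hj := j.2
      let l : Fin n := ⟨i + m, by omega⟩
      have h1 := ih l (by change (i : ℕ) ≤ i + m; omega) rfl
      have h2 : v j < v l := hv (by change (i : ℕ) + m < j; omega)
      have h3 : (l : ℕ) = i + m := rfl
      omega
  have hle : ∀ i, staircase n i ≤ v i := by
    intro i
    have hi := i.2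
    have h1 := key i ⟨n - 1, by omega⟩ (by change (i : ℕ) ≤ n - 1; omega)
    simp only [staircase, Fin.val_rev]
    simp only at h1
    omega
  refine ⟨v - staircase n, fun i j hij => ?_, ?_⟩
  · have h1 := key i j hij
    have h2 := hle i
    have h3 := hle j
    have hi := i.2
    have hj := j.2
    simp only [Pi.sub_apply, staircase, Fin.val_rev] at *
    omega
  · ext i
    simp [hle i]

/-- Antitone exponent vectors of size `d`: the partitions of `d` with at most `n` parts. -/
def partitions (n d : ℕ) : Finset (Fin n → ℕ) :=
  open scoped Classical in {lam ∈ Finset.univ.piAntidiag d | Antitone lam}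

theorem mem_partitions {d : ℕ} {lam : Fin n → ℕ} :
    lam ∈ partitions n d ↔ Antitone lam ∧ ∑ i, lam i = d := by
  simp [partitions, and_comm]

/-- An alternating polynomial vanishes if its coefficients at strictly decreasing exponents do. -/
theorem eq_zero_of_alternating {E : MvPolynomial (Fin n) ℚ}
    (hE : ∀ σ : Equiv.Perm (Fin n),
      rename σ E = ((Equiv.Perm.sign σ : ℤ) : MvPolynomial (Fin n) ℚ) * E)
    (h0 : ∀ v : Fin n → ℕ, StrictAnti v → coeff (Finsupp.equivFunOnFinite.symm v) E = 0) :
    E = 0 := by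
  have hperm : ∀ (σ : Equiv.Perm (Fin n)) (v : Fin n → ℕ),
      coeff (Finsupp.equivFunOnFinite.symm (v ∘ σ)) E =
        (Equiv.Perm.sign σ : ℤ) * coeff (Finsupp.equivFunOnFinite.symm v) E := by
    intro σ v
    have h1 := coeff_rename_mapDomain σ σ.injective E (Finsupp.equivFunOnFinite.symm (v ∘ σ))
    have h2 : Finsupp.mapDomain σ (Finsupp.equivFunOnFinite.symm (v ∘ σ)) =
        Finsupp.equivFunOnFinite.symm v := by
      ext i
      rw [← Finsupp.equivMapDomain_eq_mapDomain]
      simp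
    rw [← h1, h2, hE, ← coeff_C_mul, map_intCast]
  ext u
  rw [coeff_zero]
  obtain ⟨v, rfl⟩ := Finsupp.equivFunOnFinite.symm.surjective u
  by_cases hv : Function.Injective v
  · let σ : Equiv.Perm (Fin n) := Fin.revPerm.trans (Tuple.sort v)
    have h1 : StrictAnti (v ∘ σ) := by
      have : Antitone (v ∘ σ) := fun i j hij => by
        simpa [σ] using Tuple.monotone_sort v (Fin.rev_le_rev.2 hij)
      exact this.strictAnti_of_injective (hv.comp σ.injective)
    have h2 := h0 _ h1
    rw [hperm] at h2
    rcases mul_eq_zero.1 h2 with h | h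
    · simp at h
    · exact h
  · rw [Function.not_injective_iff] at hv
    obtain ⟨i, j, hij, hne⟩ := hv
    have h1 := hperm (Equiv.swap i j) v
    have h2 : v ∘ Equiv.swap i j = v := by
      ext l
      simp only [Function.comp, Equiv.swap_apply_def]
      split_ifs with h h' <;> simp [*]
    rw [h2, Equiv.Perm.sign_swap hne] at h1
    simp at h1
    linarith

theorem eq_sum_schurCoeff_mul_schur {p : MvPolynomial (Fin n) ℚ} (hp : p.IsSymmetric) {d : ℕ}
    (hd : p.IsHomogeneous d) :
    p = ∑ lam ∈ partitions n d, C (schurCoeff lam p) * schur n lam := by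
  refine mul_right_cancel₀ alternant_staircase_ne_zero (sub_eq_zero.1 ?_)
  simp only [Finset.sum_mul, mul_assoc, schur_mul_alternant]
  refine eq_zero_of_alternating (fun σ => ?_) fun v hv => ?_
  · rw [map_sub, map_mul, hp σ, rename_alternant, map_sum, mul_sub, Finset.mul_sum,
      mul_left_comm p]
    refine congrArg _ (Finset.sum_congr rfl fun lam _ => ?_)
    rw [map_mul, rename_C, rename_alternant, mul_left_comm]
  · obtain ⟨mu, hmu, rfl⟩ := exists_antitone_add_staircase hv
    rw [coeff_sub, ← schurCoeff_apply, coeff_sum]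
    have h1 : ∀ lam ∈ partitions n d, coeff (Finsupp.equivFunOnFinite.symm (mu + staircase n))
        (C (schurCoeff lam p) * alternant (lam + staircase n)) =
        if lam = mu then schurCoeff lam p else 0 := by
      intro lam hlam
      rw [coeff_C_mul, coeff_alternant_of_strictAnti
        (strictAnti_add_staircase (mem_partitions.1 hlam).1) hv]
      simp
    rw [Finset.sum_congr rfl h1, Finset.sum_ite_eq']
    split_ifs with h
    · rw [sub_self]
    · rw [sub_zero, schurCoeff_apply]
      refine (hd.mul (isHomogeneous_alternant _)).coeff_eq_zero fun h' => h ?_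
      rw [mem_partitions]
      refine ⟨hmu, ?_⟩
      rw [Finsupp.degree_eq_sum] at h'
      simpa [Finset.sum_add_distrib] using h'

theorem schurCoeff_eq_sum (lam : Fin n → ℕ) (p : MvPolynomial (Fin n) ℚ) :
    schurCoeff lam p = ∑ w : Equiv.Perm (Fin n), (Equiv.Perm.sign w : ℤ) *
      if ∀ i, 0 ≤ (lam i : ℤ) - i + w i then
        coeff (Finsupp.equivFunOnFinite.symm fun i => ((lam i : ℤ) - i + w i).toNat) p else 0 := by
  rw [schurCoeff_apply, alternant_eq_sum, Finset.mul_sum, coeff_sum]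
  refine Finset.sum_congr rfl fun w _ => ?_
  rw [coeff_mul_monomial', mul_comm, mul_ite, mul_zero]
  refine if_congr ?_ ?_ rfl
  · rw [Finsupp.le_def]
    refine forall_congr' fun i => ?_
    have hi := i.2
    have hw := (w i).2
    simp only [Finsupp.equivFunOnFinite_symm_apply_apply, Pi.add_apply, staircase,
      Function.comp, Fin.val_rev]
    omega
  · congr 2
    ext i
    have hi := i.2
    have hw := (w i).2
    simp only [Finsupp.equivFunOnFinite_symm_apply_apply, Pi.add_apply, staircase,
      Function.comp, Fin.val_rev, Finsupp.tsub_apply]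
    omega

end Expansion

section Words

variable {ι Y : Type} [Fintype ι] [DecidableEq Y]

/-- The number of occurrences of each letter in a word. -/
def content (c : ι → Y) (y : Y) : ℕ := Finset.card {s | c s = y}

theorem content_comp (c : ι → Y) (τ : Equiv.Perm ι) : content (c ∘ τ) = content c := by
  ext y
  simp only [content, Finset.card_filter, Function.comp]
  exact Equiv.sum_comp τ (fun s => if c s = y then 1 else 0)

theorem exists_perm_of_content_eq {c c' : ι → Y} (h : content c = content c') :
    ∃ τ : Equiv.Perm ι, c' ∘ τ = c := by
  have e : ∀ y, Nonempty ({s // c s = y} ≃ {s // c' s = y}) := fun y =>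
    ⟨Fintype.equivOfCardEq (by simpa [Fintype.card_subtype, content] using congrFun h y)⟩
  exact ⟨Equiv.ofFiberEquiv fun y => (e y).some, funext fun s => Equiv.ofFiberEquiv_map _ s⟩

variable [Fintype Y] {n : ℕ}

theorem sum_content (c : ι → Y) : ∑ y, content c y = Fintype.card ι := by
  simp only [content, ← Finset.card_univ]
  exact (Finset.card_eq_sum_card_fiberwise (fun s _ => Finset.mem_univ (c s))).symm

theorem exists_content_eq {A : Y → ℕ} (hA : ∑ y, A y = Fintype.card ι) :
    ∃ c : ι → Y, content c = A := by
  let e : ι ≃ Σ y, Fin (A y) := Fintype.equivOfCardEq (by simp [hA])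
  refine ⟨fun s => (e s).1, funext fun y => ?_⟩
  rw [content, Finset.card_filter, Equiv.sum_comp e fun t => if t.1 = y then 1 else 0,
    Fintype.sum_sigma]
  rw [Fintype.sum_eq_single y fun x hx => by simp [hx]]
  simp

theorem prod_X_eq_prod_pow_content {R : Type*} [CommSemiring R] (a : ι → Y) (x : Y → R) :
    ∏ s, x (a s) = ∏ y, x y ^ content a y := by
  rw [← Finset.prod_fiberwise_of_maps_to (g := a) (t := Finset.univ) (fun _ _ => Finset.mem_univ _)]
  refine Finset.prod_congr rfl fun y _ => ?_
  rw [Finset.prod_congr rfl (g := fun _ => x y) (fun s hs => by rw [(Finset.mem_filter.1 hs).2]),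
    Finset.prod_const, content]

theorem prod_X_eq_monomial {R : Type*} [CommSemiring R] (a : ι → Y) :
    ∏ s, (X (a s) : MvPolynomial Y R) =
      monomial (Finsupp.equivFunOnFinite.symm (content a)) 1 := by
  rw [prod_X_eq_prod_pow_content, monomial_eq, Finsupp.prod_fintype _ _ (fun _ => pow_zero _)]
  simp

theorem content_fst (c : ι → Fin n × Fin n) (i : Fin n) :
    content (fun s => (c s).1) i = ∑ j, content c (i, j) := by
  simp only [content, Finset.card_filter]
  rw [Finset.sum_comm]
  refine Finset.sum_congr rfl fun s _ => ?_
  simp only [Prod.ext_iff]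
  by_cases h : (c s).1 = i <;> simp [h]

theorem content_snd (c : ι → Fin n × Fin n) (j : Fin n) :
    content (fun s => (c s).2) j = ∑ i, content c (i, j) := by
  simp only [content, Finset.card_filter]
  rw [Finset.sum_comm]
  refine Finset.sum_congr rfl fun s _ => ?_
  simp only [Prod.ext_iff]
  by_cases h : (c s).2 = j <;> simp [h]

variable [DecidableEq ι]

theorem sum_card_stabilizer {A : Y → ℕ} (hA : ∑ y, A y = Fintype.card ι) :
    ∑ c : ι → Y with content c = A, Finset.card {σ : Equiv.Perm ι | c ∘ σ = c} =
      (Fintype.card ι).factorial := by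
  obtain ⟨c₀, hc₀⟩ := exists_content_eq hA
  rw [← Fintype.card_perm, ← Finset.card_univ, Finset.card_eq_sum_card_fiberwise
    (f := fun ρ : Equiv.Perm ι => c₀ ∘ ρ) (t := {c | content c = A})
    (fun ρ _ => by simp [content_comp, hc₀])]
  refine Finset.sum_congr rfl fun c hc => ?_
  rw [Finset.mem_filter] at hc
  obtain ⟨τ, rfl⟩ := exists_perm_of_content_eq (hc.2.trans hc₀.symm)
  refine Finset.card_bij (fun σ _ => τ * σ) ?_ ?_ ?_
  · intro σ hσ
    simpa [← Function.comp_assoc] using hσ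
  · intro σ _ σ' _ h
    exact mul_left_cancel h
  · intro ρ hρ
    refine ⟨τ⁻¹ * ρ, ?_, by simp⟩
    simp only [Finset.mem_filter, Finset.mem_univ, true_and] at hρ ⊢
    rw [← hρ]
    ext s
    have := congrFun hρ (τ⁻¹ (ρ s))
    simpa using this

theorem sum_fixed_words {M : Type*} [AddCommMonoid M] (F : (Y → ℕ) → M) :
    ∑ σ : Equiv.Perm ι, ∑ c : ι → Y with c ∘ σ = c, F (content c) =
      (Fintype.card ι).factorial • ∑ A ∈ Finset.univ.piAntidiag (Fintype.card ι), F A := by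
  simp only [Finset.sum_filter]
  rw [Finset.sum_comm, ← Finset.sum_fiberwise_of_maps_to (g := content)
    (t := Finset.univ.piAntidiag (Fintype.card ι)) (fun c _ => by simp [sum_content]),
    Finset.smul_sum]
  refine Finset.sum_congr rfl fun A hA => ?_
  rw [← sum_card_stabilizer (by simpa using hA), Finset.sum_smul]
  refine Finset.sum_congr rfl fun c hc => ?_
  rw [← Finset.sum_filter, Finset.sum_const, (Finset.mem_filter.1 hc).2]

/-- The power sum polynomial of the cycle type of `σ`, as a sum over words fixed by `σ`. -/
noncomputable def cyclePsum (n : ℕ) (σ : Equiv.Perm ι) : MvPolynomial (Fin n) ℚ :=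
  ∑ a : ι → Fin n with a ∘ σ = a, ∏ s, X (a s)

/-- The number of words of content `v` that are fixed by `σ`. -/
def fixCount (v : Fin n → ℤ) (σ : Equiv.Perm ι) : ℕ :=
  Finset.card {a : ι → Fin n | a ∘ σ = a ∧ ∀ i, (content a i : ℤ) = v i}

theorem coeff_cyclePsum (u : Fin n → ℕ) (σ : Equiv.Perm ι) :
    coeff (Finsupp.equivFunOnFinite.symm u) (cyclePsum n σ) = fixCount (fun i => (u i : ℤ)) σ := by
  simp only [cyclePsum, coeff_sum, prod_X_eq_monomial, coeff_monomial, fixCount,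
    EmbeddingLike.apply_eq_iff_eq, Nat.cast_inj]
  rw [← Finset.filter_filter, Finset.sum_boole]
  simp only [funext_iff]

theorem hsymm_eq_sum_piAntidiag (m : ℕ) :
    hsymm (Fin n) ℚ m = ∑ r ∈ Finset.univ.piAntidiag m, ∏ j, X j ^ r j := by
  rw [hsymm_eq_sum_monomial]
  refine Finset.sum_bij (fun u _ => ⇑u) ?_ ?_ ?_ ?_
  · intro u hu
    simpa using hu
  · intro u _ v _ h
    exact DFunLike.coe_injective h
  · intro r hr
    exact ⟨Finsupp.equivFunOnFinite.symm r, by simpa using hr, rfl⟩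
  · intro u _
    simp [monomial_eq, Finsupp.prod_fintype]

theorem prod_hsymm_eq (u : Fin n → ℕ) :
    ∏ i, hsymm (Fin n) ℚ (u i) =
      ∑ A ∈ (Finset.univ : Finset (Fin n × Fin n)).piAntidiag (∑ i, u i),
        if (∀ i, ∑ j, A (i, j) = u i) then ∏ j, X j ^ ∑ i, A (i, j) else 0 := by
  simp only [hsymm_eq_sum_piAntidiag]
  rw [Finset.prod_univ_sum, ← Finset.sum_filter]
  symm
  refine Finset.sum_bij (fun A _ i j => A (i, j)) ?_ ?_ ?_ ?_
  · intro A hA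
    simpa using (Finset.mem_filter.1 hA).2
  · intro A _ B _ h
    ext ⟨i, j⟩
    exact congrFun (congrFun h i) j
  · intro r hr
    refine ⟨fun q => r q.1 q.2, ?_, rfl⟩
    have h : ∀ i, ∑ j, r i j = u i := by simpa using hr
    simp [Fintype.sum_prod_type, h]
  · intro A _
    simp only [← Finset.prod_pow_eq_pow_sum]
    exact Finset.prod_comm

theorem sum_fixCount_mul_cyclePsum_nat (u : Fin n → ℕ) (hu : ∑ i, u i = Fintype.card ι) :
    ∑ σ : Equiv.Perm ι, (fixCount (fun i => (u i : ℤ)) σ : MvPolynomial (Fin n) ℚ) * cyclePsum n σ =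
      (Fintype.card ι).factorial * ∏ i, hsymm (Fin n) ℚ (u i) := by
  rw [prod_hsymm_eq, hu, ← nsmul_eq_mul, ← sum_fixed_words (ι := ι) fun A : Fin n × Fin n → ℕ =>
    if (∀ i, ∑ j, A (i, j) = u i) then
      (∏ j, X j ^ ∑ i, A (i, j) : MvPolynomial (Fin n) ℚ) else 0]
  refine Finset.sum_congr rfl fun σ _ => ?_
  rw [← Finset.sum_filter, Finset.filter_filter, fixCount, cyclePsum, ← nsmul_eq_mul,
    ← Finset.sum_const, ← Finset.sum_product']
  symm
  refine Finset.sum_bij (fun c _ => (fun s => (c s).1, fun s => (c s).2)) ?_ ?_ ?_ ?_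
  · intro c hc
    simp only [Finset.mem_filter, Finset.mem_univ, true_and, Finset.mem_product,
      content_fst] at hc ⊢
    obtain ⟨h1, h2⟩ := hc
    refine ⟨⟨?_, fun i => by exact_mod_cast h2 i⟩, ?_⟩
    · ext1 s
      exact congrArg Prod.fst (congrFun h1 s)
    · ext1 s
      exact congrArg Prod.snd (congrFun h1 s)
  · intro c _ c' _ h
    ext1 s
    exact Prod.ext (congrFun (congrArg Prod.fst h) s) (congrFun (congrArg Prod.snd h) s)
  · rintro ⟨a, b⟩ hab
    simp only [Finset.mem_filter, Finset.mem_univ, true_and, Finset.mem_product] at hab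
    obtain ⟨⟨h1, h2⟩, h3⟩ := hab
    refine ⟨fun s => (a s, b s), ?_, rfl⟩
    simp only [Finset.mem_filter, Finset.mem_univ, true_and, ← content_fst]
    exact ⟨funext fun s => Prod.ext (congrFun h1 s) (congrFun h3 s),
      fun i => by exact_mod_cast h2 i⟩
  · intro c _
    simp only [prod_X_eq_prod_pow_content (fun s => (c s).2), content_snd]

theorem sum_fixCount_mul_cyclePsum (v : Fin n → ℤ) (hv : ∑ i, v i = Fintype.card ι) :
    ∑ σ : Equiv.Perm ι, (fixCount v σ : MvPolynomial (Fin n) ℚ) * cyclePsum n σ =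
      (Fintype.card ι).factorial * ∏ i, hInt n (v i) := by
  by_cases h : ∀ i, 0 ≤ v i
  · lift v to Fin n → ℕ using h
    simp only [hInt, Int.natCast_nonneg, if_true, Int.toNat_natCast]
    exact sum_fixCount_mul_cyclePsum_nat v (by simpa only [← Nat.cast_sum, Nat.cast_inj] using hv)
  · push Not at h
    obtain ⟨i, hi⟩ := h
    rw [Finset.prod_eq_zero (Finset.mem_univ i) (by rw [hInt, if_neg (by omega)]), mul_zero]
    refine Finset.sum_eq_zero fun σ _ => ?_
    have : fixCount v σ = 0 := by
      rw [fixCount, Finset.card_eq_zero, Finset.filter_eq_empty_iff]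
      rintro a - ⟨-, ha⟩
      have := ha i
      omega
    rw [this, Nat.cast_zero, zero_mul]

/-- The class function whose Frobenius characteristic is the Schur polynomial of `lam`. -/
noncomputable def schurChar (lam : Fin n → ℕ) (σ : Equiv.Perm ι) : ℚ :=
  schurCoeff lam (cyclePsum n σ)

theorem schurChar_eq_sum (lam : Fin n → ℕ) (σ : Equiv.Perm ι) :
    schurChar lam σ = ∑ w : Equiv.Perm (Fin n), (Equiv.Perm.sign w : ℤ) *
      (fixCount (fun i => (lam i : ℤ) - i + w i) σ : ℚ) := by
  rw [schurChar, schurCoeff_eq_sum]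
  refine Finset.sum_congr rfl fun w _ => ?_
  congr 1
  split_ifs with h
  · rw [coeff_cyclePsum]
    congr 2
    ext i
    exact Int.toNat_of_nonneg (h i)
  · push Not at h
    obtain ⟨i, hi⟩ := h
    rw [fixCount, eq_comm, Nat.cast_eq_zero, Finset.card_eq_zero, Finset.filter_eq_empty_iff]
    rintro a - ⟨-, ha⟩
    have := ha i
    omega

theorem schur_eq_sum (lam : Fin n → ℕ) :
    schur n lam = ∑ w : Equiv.Perm (Fin n), ((Equiv.Perm.sign w : ℤ) : MvPolynomial (Fin n) ℚ) *
      ∏ i, hInt n ((lam i : ℤ) - i + w i) := by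
  rw [schur, ← Matrix.det_transpose, Matrix.det_apply']
  rfl

theorem sum_schurChar_mul_cyclePsum (lam : Fin n → ℕ) (hlam : ∑ i, lam i = Fintype.card ι) :
    ∑ σ : Equiv.Perm ι, C (schurChar lam σ) * cyclePsum n σ =
      (Fintype.card ι).factorial * schur n lam := by
  simp only [schurChar_eq_sum, map_sum, map_mul, map_intCast, map_natCast,
    Finset.sum_mul, mul_assoc]
  rw [Finset.sum_comm, schur_eq_sum, Finset.mul_sum]
  refine Finset.sum_congr rfl fun w _ => ?_
  rw [← Finset.mul_sum, sum_fixCount_mul_cyclePsum]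
  · exact mul_left_comm _ _ _
  · rw [Finset.sum_add_distrib, Finset.sum_sub_distrib, Equiv.sum_comp w fun i => ((i : ℕ) : ℤ),
      sub_add_cancel]
    exact_mod_cast hlam

theorem sum_schurChar_mul_schurChar {lam mu : Fin n → ℕ}
    (hlam : lam ∈ partitions n (Fintype.card ι)) (hmu : mu ∈ partitions n (Fintype.card ι)) :
    ∑ σ : Equiv.Perm ι, schurChar lam σ * schurChar mu σ =
      (Fintype.card ι).factorial * if lam = mu then 1 else 0 := by
  rw [mem_partitions] at hlam hmu
  have h := congrArg (schurCoeff mu) (sum_schurChar_mul_cyclePsum (ι := ι) lam hlam.2)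
  rw [← map_natCast C, ← smul_eq_C_mul, map_smul, schurCoeff_schur hlam.1 hmu.1, map_sum] at h
  simp only [← smul_eq_C_mul, map_smul, smul_eq_mul] at h
  exact h

end Words

section SchurCharacters

variable {ι : Type} [Fintype ι] {n : ℕ}

/-- The permutation representation of `Equiv.Perm ι` on functions of words. -/
noncomputable def wordRep (ι : Type) (n : ℕ) :
    Representation ℂ (Equiv.Perm ι) ((ι → Fin n) → ℂ) where
  toFun σ := LinearMap.funLeft ℂ ℂ fun a => a ∘ σ
  map_one' := rfl
  map_mul' _ _ := rfl

/-- The permutation representation on functions of words of content `v`. -/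
noncomputable def contentRep (ι : Type) [Fintype ι] (v : Fin n → ℤ) :
    Representation ℂ (Equiv.Perm ι) ({a : ι → Fin n // ∀ i, (content a i : ℤ) = v i} → ℂ) where
  toFun σ := LinearMap.funLeft ℂ ℂ fun a => ⟨a.1 ∘ σ, fun i => by rw [content_comp]; exact a.2 i⟩
  map_one' := rfl
  map_mul' _ _ := rfl

theorem IsConstituent.of_contentRep {v : Fin n → ℤ} {χ : Equiv.Perm ι → ℂ}
    (h : IsConstituent (contentRep ι v) χ) : IsConstituent (wordRep ι n) χ := by
  classical
  let E : ({a : ι → Fin n // ∀ i, (content a i : ℤ) = v i} → ℂ) →ₗ[ℂ] ((ι → Fin n) → ℂ) :=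
    { toFun := fun f a => if h : ∀ i, (content a i : ℤ) = v i then f ⟨a, h⟩ else 0
      map_add' := fun f g => by
        ext a
        by_cases h : ∀ i, (content a i : ℤ) = v i <;> simp [h]
      map_smul' := fun c f => by
        ext a
        by_cases h : ∀ i, (content a i : ℤ) = v i <;> simp [h] }
  refine h.of_injective E ?_ ?_
  · intro f g hfg
    ext ⟨a, ha⟩
    simpa [E, ha] using congrFun hfg a
  · intro σ f
    ext a
    change (if h : ∀ i, (content a i : ℤ) = v i then f ⟨a ∘ σ, _⟩ else 0) =
      if h : ∀ i, (content (a ∘ σ) i : ℤ) = v i then f ⟨a ∘ σ, h⟩ else 0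
    simp only [content_comp]

variable [DecidableEq ι]

theorem character_contentRep (v : Fin n → ℤ) (σ : Equiv.Perm ι) :
    (contentRep ι v).character σ = fixCount v σ := by
  rw [Representation.character, LinearMap.trace_eq_matrix_trace ℂ (Pi.basisFun ℂ _), Matrix.trace]
  have h : ∀ a : {a : ι → Fin n // ∀ i, (content a i : ℤ) = v i},
      (LinearMap.toMatrix (Pi.basisFun ℂ _) (Pi.basisFun ℂ _) (contentRep ι v σ)).diag a =
        if a.1 ∘ σ = a.1 then 1 else 0 := by
    intro a
    rw [Matrix.diag_apply, LinearMap.toMatrix_apply]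
    change (Pi.basisFun ℂ _ a : _ → ℂ) (⟨a.1 ∘ σ, _⟩ : {a : ι → Fin n // _}) = _
    simp [Pi.single_apply, Subtype.ext_iff]
  rw [Finset.sum_congr rfl fun a _ => h a, Finset.sum_boole, fixCount, Nat.cast_inj]
  refine Finset.card_bij (fun a _ => a.1) ?_ ?_ ?_
  · intro a ha
    simpa using ⟨by simpa using ha, a.2⟩
  · intro a _ b _ h
    exact Subtype.ext h
  · intro a ha
    simp only [Finset.mem_filter, Finset.mem_univ, true_and] at ha
    exact ⟨⟨a, ha.2⟩, by simpa using ha.1, rfl⟩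

theorem fixCount_mem_span (v : Fin n → ℤ) :
    (fun σ : Equiv.Perm ι => (fixCount v σ : ℂ)) ∈
      Submodule.span ℤ {χ | IsConstituent (wordRep ι n) χ} := by
  obtain ⟨l, hl, hsum⟩ := exists_constituents (contentRep ι v)
  have : (fun σ : Equiv.Perm ι => (fixCount v σ : ℂ)) = l.sum := by
    rw [← hsum]
    exact funext fun σ => (character_contentRep v σ).symm
  rw [this]
  exact multiset_sum_mem _ fun χ hχ => Submodule.subset_span (hl χ hχ).of_contentRep

theorem schurChar_mem_span (lam : Fin n → ℕ) :
    (fun σ : Equiv.Perm ι => (schurChar lam σ : ℂ)) ∈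
      Submodule.span ℤ {χ | IsConstituent (wordRep ι n) χ} := by
  have : (fun σ : Equiv.Perm ι => (schurChar lam σ : ℂ)) = ∑ w : Equiv.Perm (Fin n),
      (Equiv.Perm.sign w : ℤ) •
        fun σ : Equiv.Perm ι => (fixCount (fun i => (lam i : ℤ) - i + w i) σ : ℂ) := by
    ext σ
    rw [schurChar_eq_sum, Finset.sum_apply]
    push_cast
    refine Finset.sum_congr rfl fun w _ => ?_
    rw [Pi.smul_apply, zsmul_eq_mul]
  rw [this]
  exact Submodule.sum_mem _ fun w _ => Submodule.smul_mem _ _ (fixCount_mem_span _)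

theorem fixCount_inv (v : Fin n → ℤ) (σ : Equiv.Perm ι) : fixCount v σ⁻¹ = fixCount v σ := by
  rw [fixCount, fixCount]
  congr 1
  ext a
  have : a ∘ ⇑σ⁻¹ = a ↔ a ∘ σ = a := by
    constructor <;> intro h
    · ext1 s
      simpa using (congrFun h (σ s)).symm
    · ext1 s
      simpa using (congrFun h (σ⁻¹ s)).symm
  simp only [Finset.mem_filter, this]

theorem schurChar_inv (lam : Fin n → ℕ) (σ : Equiv.Perm ι) :
    schurChar lam σ⁻¹ = schurChar lam σ := by
  simp only [schurChar_eq_sum, fixCount_inv]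

theorem fixCount_conj (v : Fin n → ℤ) (σ τ : Equiv.Perm ι) :
    fixCount v (τ * σ * τ⁻¹) = fixCount v σ := by
  refine Finset.card_bij (fun a _ => a ∘ τ) ?_ ?_ ?_
  · intro a ha
    simp only [Finset.mem_filter, Finset.mem_univ, true_and, content_comp] at ha ⊢
    refine ⟨funext fun s => ?_, ha.2⟩
    simpa using congrFun ha.1 (τ s)
  · intro a _ b _ h
    exact τ.surjective.injective_comp_right h
  · intro a ha
    refine ⟨a ∘ ⇑τ⁻¹, ?_, by ext1; simp⟩
    simp only [Finset.mem_filter, Finset.mem_univ, true_and, content_comp] at ha ⊢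
    refine ⟨funext fun s => ?_, ha.2⟩
    simpa using congrFun ha.1 (τ⁻¹ s)

theorem schurChar_conj (lam : Fin n → ℕ) (σ τ : Equiv.Perm ι) :
    schurChar lam (τ * σ * τ⁻¹) = schurChar lam σ := by
  simp only [schurChar_eq_sum, fixCount_conj]

theorem charInner_schurChar_self {lam : Fin n → ℕ} (hlam : lam ∈ partitions n (Fintype.card ι)) :
    charInner (fun σ : Equiv.Perm ι => (schurChar lam σ : ℂ))
      (fun σ : Equiv.Perm ι => (schurChar lam σ : ℂ)) = 1 := by
  rw [charInner_apply]
  simp only [schurChar_inv]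
  have h := sum_schurChar_mul_schurChar hlam hlam
  rw [if_pos rfl, mul_one] at h
  have h' : ∑ σ : Equiv.Perm ι, (schurChar lam σ : ℂ) * schurChar lam σ =
      (Fintype.card ι).factorial := by exact_mod_cast h
  rw [h', Nat.card_eq_fintype_card, Fintype.card_perm]
  exact inv_mul_cancel₀ (Nat.cast_ne_zero.2 (Nat.factorial_ne_zero _))

theorem eval_alternant (α : Fin n → ℕ) :
    eval (fun j : Fin n => (2 : ℚ) ^ (j : ℕ)) (alternant α) =
      ∏ i : Fin n, ∏ j ∈ Finset.Ioi i, ((2 : ℚ) ^ α j - 2 ^ α i) := by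
  rw [← Matrix.det_vandermonde, alternant, RingHom.map_det]
  congr 1
  ext1 i j
  simp [Matrix.vandermonde, ← pow_mul, mul_comm]

theorem eval_schur_pos {lam : Fin n → ℕ} (hlam : Antitone lam) :
    0 < eval (fun j : Fin n => (2 : ℚ) ^ (j : ℕ)) (schur n lam) := by
  have h := congrArg (eval (fun j : Fin n => (2 : ℚ) ^ (j : ℕ))) (schur_mul_alternant lam)
  rw [map_mul] at h
  have hpos : 0 < eval (fun j : Fin n => (2 : ℚ) ^ (j : ℕ)) (alternant (staircase n)) *
      eval (fun j : Fin n => (2 : ℚ) ^ (j : ℕ)) (alternant (lam + staircase n)) := by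
    simp only [eval_alternant, ← Finset.prod_mul_distrib]
    refine Finset.prod_pos fun i _ => Finset.prod_pos fun j hj => ?_
    rw [Finset.mem_Ioi] at hj
    have h1 := strictAnti_staircase hj
    have h2 := strictAnti_add_staircase hlam hj
    refine mul_pos_of_neg_of_neg (sub_neg.2 ?_) (sub_neg.2 ?_)
    · exact pow_lt_pow_right₀ one_lt_two h1
    · exact pow_lt_pow_right₀ one_lt_two h2
  rw [← h] at hpos
  nlinarith [sq_nonneg (eval (fun j : Fin n => (2 : ℚ) ^ (j : ℕ)) (alternant (staircase n)))]

theorem exists_coeff_schur_pos {lam : Fin n → ℕ} (hlam : Antitone lam) :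
    ∃ u : Fin n → ℕ, 0 < coeff (Finsupp.equivFunOnFinite.symm u) (schur n lam) := by
  by_contra! h
  refine (eval_schur_pos hlam).not_ge ?_
  rw [eval_eq']
  refine Finset.sum_nonpos fun u _ => mul_nonpos_of_nonpos_of_nonneg ?_ (by positivity)
  simpa using h u

theorem isConstituent_schurChar {lam : Fin n → ℕ} (hlam : lam ∈ partitions n (Fintype.card ι)) :
    IsConstituent (wordRep ι n) (fun σ => (schurChar lam σ : ℂ)) := by
  have hl := mem_partitions.1 hlam
  obtain ⟨u, hu⟩ := exists_coeff_schur_pos hl.1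
  refine isConstituent_of_charInner_self_eq_one (schurChar_mem_span lam)
    (charInner_schurChar_self hlam) (contentRep ι fun i => (u i : ℤ)) ?_
  have h := congrArg (coeff (Finsupp.equivFunOnFinite.symm u))
    (sum_schurChar_mul_cyclePsum (ι := ι) lam hl.2)
  rw [← map_natCast C, coeff_C_mul, coeff_sum] at h
  simp only [coeff_C_mul, coeff_cyclePsum] at h
  have h' : charInner (fun σ : Equiv.Perm ι => (schurChar lam σ : ℂ))
      (contentRep ι fun i => (u i : ℤ)).character =
      ((coeff (Finsupp.equivFunOnFinite.symm u) (schur n lam) : ℚ) : ℂ) := by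
    rw [charInner_apply]
    simp only [character_contentRep, fixCount_inv]
    rw [Nat.card_eq_fintype_card, Fintype.card_perm, inv_mul_eq_iff_eq_mul₀
      (Nat.cast_ne_zero.2 (Nat.factorial_ne_zero _))]
    exact_mod_cast h
  rw [h', Complex.ratCast_re]
  exact_mod_cast hu

end SchurCharacters

section Polarization

variable {ι Y : Type} [Fintype ι] [DecidableEq ι] [DecidableEq Y] {n : ℕ}

theorem card_comp_eq {c₀ c : ι → Y} (h : content c = content c₀) :
    Finset.card {ρ : Equiv.Perm ι | c₀ ∘ ρ = c} = Finset.card {ρ : Equiv.Perm ι | c₀ ∘ ρ = c₀} := by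
  obtain ⟨τ, rfl⟩ := exists_perm_of_content_eq h
  refine Finset.card_bij (fun ρ _ => ρ * τ⁻¹) ?_ ?_ ?_
  · intro ρ hρ
    simp only [Finset.mem_filter, Finset.mem_univ, true_and] at hρ ⊢
    ext1 s
    simpa using congrFun hρ (τ⁻¹ s)
  · intro ρ _ ρ' _ h
    exact mul_right_cancel h
  · intro ρ hρ
    refine ⟨ρ * τ, ?_, by simp⟩
    simp only [Finset.mem_filter, Finset.mem_univ, true_and] at hρ ⊢
    ext1 s
    simpa using congrFun hρ (τ s)

variable [Fintype Y]

/-- Polarization: a homogeneous form that vanishes identically has vanishing symmetrization. -/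
theorem sum_perm_eq_zero_of_form_eq_zero (D : (ι → Y) → ℂ)
    (hD : ∀ x : Y → ℂ, ∑ c, D c * ∏ s, x (c s) = 0) (c₀ : ι → Y) :
    ∑ σ : Equiv.Perm ι, D (c₀ ∘ σ) = 0 := by
  have hF : ∑ c : ι → Y, C (D c) * ∏ s, (X (c s) : MvPolynomial Y ℂ) = 0 := by
    refine MvPolynomial.funext fun x => ?_
    simpa using hD x
  have hcoeff := congrArg (coeff (Finsupp.equivFunOnFinite.symm (content c₀))) hF
  simp only [coeff_sum, coeff_C_mul, prod_X_eq_monomial, coeff_monomial,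
    EmbeddingLike.apply_eq_iff_eq, coeff_zero, mul_ite, mul_one, mul_zero] at hcoeff
  rw [← Finset.sum_filter] at hcoeff
  rw [← Finset.sum_fiberwise_of_maps_to (g := fun σ : Equiv.Perm ι => c₀ ∘ σ)
    (t := {c | content c = content c₀}) (fun σ _ => by simp [content_comp])]
  rw [Finset.sum_congr rfl (g := fun c => Finset.card {ρ : Equiv.Perm ι | c₀ ∘ ρ = c₀} * D c),
    ← Finset.mul_sum, hcoeff, mul_zero]
  intro c hc
  rw [← card_comp_eq (Finset.mem_filter.1 hc).2, ← nsmul_eq_mul, ← Finset.sum_const]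
  exact Finset.sum_congr rfl fun σ hσ => by rw [(Finset.mem_filter.1 hσ).2]

open Matrix in
/-- A polynomial that vanishes at Hermitian matrices vanishes at all matrices. -/
theorem form_eq_zero_of_isHermitian (D : (ι → Fin n × Fin n) → ℂ)
    (hD : ∀ M : Matrix (Fin n) (Fin n) ℂ, M.IsHermitian → ∑ c, D c * ∏ s, M (c s).1 (c s).2 = 0)
    (M : Matrix (Fin n) (Fin n) ℂ) : ∑ c, D c * ∏ s, M (c s).1 (c s).2 = 0 := by
  let A : Matrix (Fin n) (Fin n) ℂ := (2⁻¹ : ℂ) • (M + Mᴴ)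
  let B : Matrix (Fin n) (Fin n) ℂ := (2⁻¹ * Complex.I) • (Mᴴ - M)
  have hA : A.IsHermitian := by
    ext i j
    simp [A, add_comm]
  have hB : B.IsHermitian := by
    ext i j
    simp [B]
    ring
  have hM : ∀ i j, M i j = A i j + Complex.I * B i j := by
    intro i j
    simp only [A, B, Matrix.smul_apply, Matrix.add_apply, Matrix.sub_apply, smul_eq_mul]
    linear_combination (2⁻¹ * M i j - 2⁻¹ * Mᴴ i j) * Complex.I_mul_I
  let p : Polynomial ℂ := ∑ c, Polynomial.C (D c) *
    ∏ s, (Polynomial.C (A (c s).1 (c s).2) + Polynomial.X * Polynomial.C (B (c s).1 (c s).2))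
  have heval : ∀ z, p.eval z = ∑ c, D c * ∏ s, (A (c s).1 (c s).2 + z * B (c s).1 (c s).2) := by
    intro z
    simp [p, Polynomial.eval_finsetSum, Polynomial.eval_prod, mul_comm z]
  have hp : p = 0 := by
    refine Polynomial.eq_zero_of_infinite_isRoot p
      ((Set.infinite_range_of_injective Complex.ofReal_injective).mono ?_)
    rintro _ ⟨t, rfl⟩
    change p.eval _ = 0
    rw [heval]
    have hAB : (A + (t : ℂ) • B).IsHermitian := by
      refine hA.add ?_
      rw [Matrix.IsHermitian, Matrix.conjTranspose_smul, hB.eq]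
      simp
    simpa using hD _ hAB
  have := heval Complex.I
  rw [hp, Polynomial.eval_zero] at this
  simp only [hM]
  exact this.symm

/-- The trace of a permutation of tensor factors composed with a tensor power. -/
theorem sum_prod_perm_of_diagonalization {P Q : Matrix (Fin n) (Fin n) ℂ} (hQP : Q * P = 1)
    (x : Fin n → ℂ) (σ : Equiv.Perm ι) :
    ∑ a : ι → Fin n, ∏ s, (P * Matrix.diagonal x * Q) (a s) (a (σ s)) =
      ∑ a : ι → Fin n with a ∘ σ = a, ∏ s, x (a s) := by
  have hentry : ∀ p q, (P * Matrix.diagonal x * Q) p q = ∑ r, P p r * x r * Q r q := by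
    intro p q
    rw [Matrix.mul_apply]
    simp only [Matrix.mul_diagonal]
  have hsum : ∀ r r', ∑ p, Q r' p * P p r = if r' = r then 1 else 0 := by
    intro r r'
    rw [← Matrix.mul_apply, hQP, Matrix.one_apply]
  simp only [hentry, Finset.prod_univ_sum, Fintype.piFinset_univ]
  rw [Finset.sum_comm, Finset.sum_filter]
  refine Finset.sum_congr rfl fun r _ => ?_
  have h1 : ∀ a : ι → Fin n, ∏ s, P (a s) (r s) * x (r s) * Q (r s) (a (σ s)) =
      (∏ s, x (r s)) * ∏ s, Q (r s) (a (σ s)) * P (a (σ s)) (r (σ s)) := by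
    intro a
    rw [Finset.prod_mul_distrib, Finset.prod_mul_distrib, Finset.prod_mul_distrib,
      Equiv.prod_comp σ fun s => P (a s) (r s)]
    ring
  simp only [h1]
  rw [← Finset.mul_sum]
  have h2 : ∑ a : ι → Fin n, ∏ s, Q (r s) (a (σ s)) * P (a (σ s)) (r (σ s)) =
      ∑ a : ι → Fin n, ∏ s, Q (r s) (a s) * P (a s) (r (σ s)) :=
    Equiv.sum_comp (σ.symm.arrowCongr (Equiv.refl (Fin n)))
      fun a => ∏ s, Q (r s) (a s) * P (a s) (r (σ s))
  have h3 : ∑ a : ι → Fin n, ∏ s, Q (r s) (a s) * P (a s) (r (σ s)) =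
      ∏ s, if r s = r (σ s) then 1 else 0 := by
    rw [← Finset.prod_congr rfl fun s _ => hsum (r (σ s)) (r s), Finset.prod_univ_sum,
      Fintype.piFinset_univ]
  rw [h2, h3, Finset.prod_ite_zero]
  have h4 : (∀ s ∈ Finset.univ, r s = r (σ s)) ↔ r ∘ σ = r := by
    simp [_root_.funext_iff, eq_comm]
  simp only [h4]
  split_ifs <;> simp

end Polarization

section Positivity

open scoped ComplexOrder ComplexConjugate

variable {ι : Type} [Fintype ι] [DecidableEq ι] {n : ℕ}

theorem sum_comm_triple {α β γ : Type*} [Fintype α] [Fintype β] [Fintype γ] (F : α → β → γ → ℂ) :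
    ∑ u, ∑ a, ∑ b, F u a b = ∑ a, ∑ b, ∑ u, F u a b :=
  Finset.sum_comm.trans (Finset.sum_congr rfl fun _ _ => Finset.sum_comm)

/-- If a positive semidefinite kernel and a class function `f` on the symmetric group define the
same form on Hermitian matrices, then `f` acts on words with nonnegative eigenvalues. -/
theorem eigenvalue_nonneg_of_form_eq {U : Type} [Fintype U] (V : U → (ι → Fin n) → ℂ)
    (hV : ∀ u a, conj (V u a) = V u a) (f : Equiv.Perm ι → ℂ)
    (hf : ∀ σ τ, f (τ * σ * τ⁻¹) = f σ) {r : ℝ} (hr : 0 < r)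
    (hform : ∀ M : Matrix (Fin n) (Fin n) ℂ, M.IsHermitian →
      ∑ u, ∑ a : ι → Fin n, ∑ b : ι → Fin n, V u a * V u b * ∏ s, M (a s) (b s) =
        r * ∑ σ, f σ * ∑ a : ι → Fin n, ∏ s, M (a s) (a (σ s)))
    (z : ℂ) (v : (ι → Fin n) → ℂ) (hv : v ≠ 0) (hz : ∑ σ, f σ • wordRep ι n σ v = z • v) :
    0 ≤ z := by
  let C' : (ι → Fin n) → (ι → Fin n) → ℂ :=
    fun a b => ∑ σ : Equiv.Perm ι, if b = a ∘ σ then f σ else 0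
  have hC' : ∀ (τ : Equiv.Perm ι) a b, C' (a ∘ τ) (b ∘ τ) = C' a b := by
    intro τ a b
    refine Eq.trans (Finset.sum_congr rfl fun σ _ => ?_) (Equiv.sum_comp (MulAut.conj τ).toEquiv
      fun σ : Equiv.Perm ι => if b = a ∘ σ then f σ else 0)
    have h : b ∘ τ = (a ∘ τ) ∘ σ ↔ b = a ∘ (τ * σ * τ⁻¹ : Equiv.Perm ι) := by
      constructor <;> intro h <;> ext1 s
      · simpa using congrFun h (τ⁻¹ s)
      · simpa using congrFun h (τ s)
    change _ = if b = a ∘ (τ * σ * τ⁻¹ : Equiv.Perm ι) then f (τ * σ * τ⁻¹) else 0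
    rw [hf]
    simp only [h]
  have hrow : ∀ (g : (ι → Fin n) → ℂ) a, ∑ b, C' a b * g b = ∑ σ, f σ * g (a ∘ σ) := by
    intro g a
    simp only [C', Finset.sum_mul, ite_mul, zero_mul]
    rw [Finset.sum_comm]
    simp
  have hsym : ∀ a b, ∑ σ : Equiv.Perm ι, ∑ u, V u (a ∘ σ) * V u (b ∘ σ) =
      r * (Fintype.card ι).factorial * C' a b := by
    intro a b
    have h := sum_perm_eq_zero_of_form_eq_zero (ι := ι)
      (fun c : ι → Fin n × Fin n => ∑ u, V u (fun s => (c s).1) * V u (fun s => (c s).2) -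
        r * C' (fun s => (c s).1) (fun s => (c s).2)) ?_ (fun s => (a s, b s))
    · rw [Finset.sum_sub_distrib, sub_eq_zero] at h
      refine h.trans ?_
      change ∑ τ : Equiv.Perm ι, (r : ℂ) * C' (a ∘ τ) (b ∘ τ) = _
      simp only [hC']
      rw [Finset.sum_const, Finset.card_univ, Fintype.card_perm, nsmul_eq_mul]
      ring
    · intro x
      refine form_eq_zero_of_isHermitian _ (fun M hM => ?_) (Matrix.of fun i j => x (i, j))
      rw [← Equiv.sum_comp (Equiv.arrowProdEquivProdArrow ι (fun _ => Fin n) (fun _ => Fin n)).symm,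
        Fintype.sum_prod_type]
      change ∑ a : ι → Fin n, ∑ b : ι → Fin n,
        (∑ u, V u a * V u b - r * C' a b) * ∏ s, M (a s) (b s) = 0
      have hC : ∑ a : ι → Fin n, ∑ b : ι → Fin n, C' a b * ∏ s, M (a s) (b s) =
          ∑ σ, f σ * ∑ a : ι → Fin n, ∏ s, M (a s) (a (σ s)) := by
        simp only [hrow, Finset.mul_sum]
        rw [Finset.sum_comm]
        rfl
      have hVV : ∑ a : ι → Fin n, ∑ b : ι → Fin n, (∑ u, V u a * V u b) * ∏ s, M (a s) (b s) =
          ∑ u, ∑ a : ι → Fin n, ∑ b : ι → Fin n, V u a * V u b * ∏ s, M (a s) (b s) := by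
        simp only [Finset.sum_mul]
        exact (sum_comm_triple _).symm
      simp only [sub_mul, Finset.sum_sub_distrib, mul_assoc (r : ℂ), ← Finset.mul_sum]
      rw [hVV, hC, hform M hM, sub_self]
  have hq : 0 < ∑ a, conj (v a) * v a := by
    obtain ⟨a, ha⟩ := Function.ne_iff.1 hv
    refine Finset.sum_pos' (fun a _ => star_mul_self_nonneg (v a)) ⟨a, Finset.mem_univ _, ?_⟩
    exact star_mul_self_pos (IsRegular.of_ne_zero ha)
  have hmain : z * (r * (Fintype.card ι).factorial * ∑ a, conj (v a) * v a) =
      ∑ σ : Equiv.Perm ι, ∑ u, conj (∑ b, V u (b ∘ σ) * v b) * ∑ b, V u (b ∘ σ) * v b := by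
    have hzv : ∀ a, z * v a = ∑ b, C' a b * v b := by
      intro a
      rw [hrow]
      have h := (congrFun hz a).symm
      rw [Finset.sum_apply] at h
      exact h
    have hexp : ∀ (σ : Equiv.Perm ι) u,
        conj (∑ b, V u (b ∘ σ) * v b) * ∑ b, V u (b ∘ σ) * v b =
          ∑ a, ∑ b, conj (v a) * v b * (V u (a ∘ σ) * V u (b ∘ σ)) := by
      intro σ u
      rw [map_sum, Finset.sum_mul_sum]
      refine Finset.sum_congr rfl fun a _ => Finset.sum_congr rfl fun b _ => ?_
      rw [map_mul, hV]
      ring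
    have hswap : ∑ σ : Equiv.Perm ι, ∑ u, ∑ a, ∑ b,
        conj (v a) * v b * (V u (a ∘ σ) * V u (b ∘ σ)) =
          ∑ a, ∑ b, conj (v a) * v b * ∑ σ : Equiv.Perm ι, ∑ u, V u (a ∘ σ) * V u (b ∘ σ) := by
      simp only [Finset.mul_sum]
      exact (Finset.sum_congr rfl fun σ _ => sum_comm_triple _).trans (sum_comm_triple _)
    simp only [hexp]
    rw [hswap]
    simp only [hsym]
    rw [Finset.mul_sum, Finset.mul_sum]
    refine Finset.sum_congr rfl fun a _ => ?_
    calc z * (r * (Fintype.card ι).factorial * (conj (v a) * v a))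
        = r * (Fintype.card ι).factorial * conj (v a) * (z * v a) := by ring
      _ = _ := by
        rw [hzv, Finset.mul_sum]
        exact Finset.sum_congr rfl fun b _ => by ring
  have hnonneg : 0 ≤ z * (r * (Fintype.card ι).factorial * ∑ a, conj (v a) * v a) := by
    rw [hmain]
    exact Finset.sum_nonneg fun σ _ => Finset.sum_nonneg fun u _ => star_mul_self_nonneg _
  have hpos : 0 < r * (Fintype.card ι).factorial * ∑ a, conj (v a) * v a :=
    mul_pos (mul_pos (by exact_mod_cast hr) (by exact_mod_cast Nat.factorial_pos _)) hq
  have h := mul_nonneg hnonneg (inv_pos.2 hpos).le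
  rwa [mul_assoc, mul_inv_cancel₀ hpos.ne', mul_one] at h

end Positivity

section Antisymmetrizer

open Matrix

variable {k m n : ℕ}

/-- The matrix of the unnormalized antisymmetrizer on words of length `k`. -/
def antisym (a b : Fin k → Fin n) : ℂ :=
  ∑ π : Equiv.Perm (Fin k), (Equiv.Perm.sign π : ℤ) * if a = b ∘ π then 1 else 0

theorem sum_mul_antisym (F : (Fin k → Fin n) → ℂ) (b : Fin k → Fin n) :
    ∑ a, F a * antisym a b = ∑ π : Equiv.Perm (Fin k), (Equiv.Perm.sign π : ℤ) * F (b ∘ π) := by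
  simp only [antisym, Finset.mul_sum]
  rw [Finset.sum_comm]
  refine Finset.sum_congr rfl fun π _ => ?_
  simp [mul_comm]

theorem antisym_comp (a b : Fin k → Fin n) (ρ : Equiv.Perm (Fin k)) :
    antisym a (b ∘ ρ) = (Equiv.Perm.sign ρ : ℤ) * antisym a b := by
  rw [antisym, antisym, Finset.mul_sum, ← Equiv.sum_comp (Equiv.mulLeft ρ⁻¹)]
  refine Finset.sum_congr rfl fun π _ => ?_
  have h : (b ∘ ρ) ∘ (ρ⁻¹ * π : Equiv.Perm (Fin k)) = b ∘ π := by
    ext1 s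
    simp
  simp only [Equiv.coe_mulLeft, h, Equiv.Perm.sign_mul, Equiv.Perm.sign_inv]
  push_cast
  ring

theorem antisym_comm (a b : Fin k → Fin n) : antisym a b = antisym b a := by
  rw [antisym, antisym, ← Equiv.sum_comp (Equiv.inv (Equiv.Perm (Fin k)))]
  refine Finset.sum_congr rfl fun π _ => ?_
  have h : a = b ∘ (π⁻¹ : Equiv.Perm (Fin k)) ↔ b = a ∘ π := by
    constructor <;> rintro rfl <;> ext1 s <;> simp
  simp only [Equiv.inv_apply, Equiv.Perm.sign_inv, h]

theorem antisym_eq_zero (a : Fin k → Fin n) {b : Fin k → Fin n} (hb : ¬ Function.Injective b) :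
    antisym a b = 0 := by
  simp only [Function.Injective, not_forall] at hb
  obtain ⟨i, j, hij, hne⟩ := hb
  have h : b ∘ Equiv.swap i j = b := by
    ext1 s
    simp only [Function.comp_apply, Equiv.swap_apply_def]
    split_ifs with h1 h2
    · rw [h1, hij]
    · rw [h2, hij]
    · rfl
  have h' := antisym_comp a b (Equiv.swap i j)
  rw [h, Equiv.Perm.sign_swap hne] at h'
  push_cast at h'
  linear_combination h' / 2

/-- The increasing word listing the elements of a set. -/
def sortedWord (S : {S : Finset (Fin n) // S.card = k}) : Fin k → Fin n :=
  S.1.orderEmbOfFin S.2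

theorem sortedWord_injective (S : {S : Finset (Fin n) // S.card = k}) :
    Function.Injective (sortedWord S) :=
  (S.1.orderEmbOfFin S.2).injective

theorem range_sortedWord (S : {S : Finset (Fin n) // S.card = k}) :
    Set.range (sortedWord S) = S.1 :=
  Finset.range_orderEmbOfFin S.1 S.2

theorem sum_sortedWord (S : {S : Finset (Fin n) // S.card = k}) (x : Fin n → ℂ) :
    ∑ i, x (sortedWord S i) = ∑ i ∈ S.1, x i := by
  rw [← Finset.sum_image (fun i _ j _ h => sortedWord_injective S h)]
  congr 1
  rw [← Finset.coe_inj, ← range_sortedWord S]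
  simp

theorem exists_eq_sortedWord_comp {b : Fin k → Fin n} (hb : Function.Injective b) :
    ∃ (S : {S : Finset (Fin n) // S.card = k}) (ρ : Equiv.Perm (Fin k)), b = sortedWord S ∘ ρ := by
  let S : {S : Finset (Fin n) // S.card = k} :=
    ⟨Finset.univ.image b, by rw [Finset.card_image_of_injective _ hb, Finset.card_fin]⟩
  have hmem : ∀ i, ∃ j, sortedWord S j = b i := by
    intro i
    change b i ∈ Set.range (sortedWord S)
    rw [range_sortedWord]
    simp [S]
  choose ρ hρ using hmem
  have hinj : Function.Injective ρ := fun i j h => hb (by rw [← hρ, ← hρ, h])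
  refine ⟨S, Equiv.ofBijective ρ (Finite.injective_iff_bijective.1 hinj), ?_⟩
  ext1 i
  exact (hρ i).symm

theorem antisym_sortedWord (S T : {S : Finset (Fin n) // S.card = k}) :
    antisym (sortedWord S) (sortedWord T) = if S = T then 1 else 0 := by
  split_ifs with h
  · subst h
    rw [antisym, Finset.sum_eq_single 1]
    · simp
    · intro π _ hπ
      rw [if_neg, mul_zero]
      intro h
      refine hπ (Equiv.ext fun i => ?_)
      exact (sortedWord_injective S (congrFun h i)).symm
    · simp
  · refine Finset.sum_eq_zero fun π _ => ?_
    rw [if_neg, mul_zero]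
    intro h'
    refine h (Subtype.ext (Finset.coe_injective ?_))
    rw [← range_sortedWord, ← range_sortedWord, h', Set.range_comp, π.surjective.range_eq,
      Set.image_univ]

theorem sign_mul_self {ι : Type*} [Fintype ι] [DecidableEq ι] (π : Equiv.Perm ι) :
    ((Equiv.Perm.sign π : ℤ) : ℂ) * (Equiv.Perm.sign π : ℤ) = 1 := by
  rcases Int.units_eq_one_or (Equiv.Perm.sign π) with h | h <;> simp [h]

/-- The columns of the antisymmetrizer that form a basis of its range. -/
def antisymBasis (n k : ℕ) : Matrix (Fin k → Fin n) {S : Finset (Fin n) // S.card = k} ℂ :=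
  of fun a S => antisym a (sortedWord S)

theorem antisymBasis_mul_transpose :
    antisymBasis n k * (antisymBasis n k)ᵀ = of fun a b => antisym a b := by
  ext a b
  simp only [mul_apply, antisymBasis, of_apply, transpose_apply]
  by_cases hb : Function.Injective b
  · obtain ⟨S, ρ, rfl⟩ := exists_eq_sortedWord_comp hb
    have h : ∀ T, antisym (sortedWord S ∘ ρ) (sortedWord T) =
        (Equiv.Perm.sign ρ : ℤ) * if T = S then 1 else 0 := by
      intro T
      rw [antisym_comm, antisym_comp, antisym_sortedWord]
    simp only [h, antisym_comp]
    simp [mul_comm]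
  · rw [antisym_eq_zero a hb]
    refine Finset.sum_eq_zero fun S _ => ?_
    rw [antisym_comm b, antisym_eq_zero _ hb, mul_zero]

/-- Compressing a diagonal operator on words to the range of the antisymmetrizer. -/
theorem antisymBasis_compress_diagonal (F : (Fin k → Fin n) → ℂ) :
    (antisymBasis n k)ᵀ * diagonal F * antisymBasis n k =
      diagonal fun S => ∑ π : Equiv.Perm (Fin k), F (sortedWord S ∘ π) := by
  ext T S
  rw [mul_apply]
  simp only [mul_diagonal, antisymBasis, of_apply, transpose_apply]
  rw [sum_mul_antisym]
  have h : ∀ π : Equiv.Perm (Fin k), antisym (sortedWord S ∘ π) (sortedWord T) =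
      (Equiv.Perm.sign π : ℤ) * if T = S then 1 else 0 := by
    intro π
    rw [antisym_comm, antisym_comp, antisym_sortedWord]
  simp only [h, diagonal_apply]
  split_ifs with hTS
  · subst hTS
    refine Finset.sum_congr rfl fun π _ => ?_
    linear_combination F (sortedWord T ∘ π) * sign_mul_self π
  · simp

theorem transpose_mul_antisymBasis :
    (antisymBasis n k)ᵀ * antisymBasis n k = (k.factorial : ℂ) • 1 := by
  have h := antisymBasis_compress_diagonal (n := n) (k := k) fun _ => 1
  rw [diagonal_one, Matrix.mul_one] at h
  rw [h]
  ext S T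
  simp [diagonal_apply, one_apply, Fintype.card_perm]

/-- The tensor product of a family of matrices, acting on words. -/
def tensorMatrix (g : Fin k → Matrix (Fin n) (Fin n) ℂ) :
    Matrix (Fin k → Fin n) (Fin k → Fin n) ℂ :=
  of fun a b => ∏ i, g i (a i) (b i)

theorem tensorMatrix_mul (g h : Fin k → Matrix (Fin n) (Fin n) ℂ) :
    tensorMatrix g * tensorMatrix h = tensorMatrix (g * h) := by
  ext a b
  simp only [mul_apply, tensorMatrix, of_apply, Pi.mul_apply, Finset.prod_univ_sum,
    Fintype.piFinset_univ, Finset.prod_mul_distrib]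

theorem tensorMatrix_one : tensorMatrix (1 : Fin k → Matrix (Fin n) (Fin n) ℂ) = 1 := by
  ext a b
  simp only [tensorMatrix, of_apply, Pi.one_apply, one_apply, Finset.prod_ite_zero]
  simp [_root_.funext_iff]

theorem antisym_mul_tensorMatrix (g : Matrix (Fin n) (Fin n) ℂ) :
    (of fun a b => antisym a b) * tensorMatrix (fun _ : Fin k => g) =
      tensorMatrix (fun _ : Fin k => g) * of fun a b => antisym a b := by
  ext a b
  simp only [mul_apply, of_apply]
  rw [sum_mul_antisym]
  have h : ∀ c, antisym a c * tensorMatrix (fun _ : Fin k => g) c b =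
      tensorMatrix (fun _ : Fin k => g) c b * antisym c a := by
    intro c
    rw [antisym_comm, mul_comm]
  simp only [h]
  rw [sum_mul_antisym fun c => tensorMatrix (fun _ : Fin k => g) c b,
    ← Equiv.sum_comp (Equiv.inv (Equiv.Perm (Fin k)))]
  refine Finset.sum_congr rfl fun π _ => ?_
  simp only [Equiv.inv_apply, Equiv.Perm.sign_inv, tensorMatrix, of_apply]
  congr 1
  rw [← Equiv.prod_comp π]
  simp

/-- Conjugation-invariance of the determinant of an operator compressed to the range of the
antisymmetrizer. -/
theorem det_compress_conj {P Q : Matrix (Fin n) (Fin n) ℂ} (hPQ : P * Q = 1)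
    (K : Matrix (Fin k → Fin n) (Fin k → Fin n) ℂ) :
    ((antisymBasis n k)ᵀ * (tensorMatrix (fun _ => P) * K * tensorMatrix (fun _ => Q)) *
      antisymBasis n k).det = ((antisymBasis n k)ᵀ * K * antisymBasis n k).det := by
  set B := antisymBasis n k
  set p := tensorMatrix (fun _ : Fin k => P)
  set q := tensorMatrix (fun _ : Fin k => Q)
  set c : ℂ := (k.factorial : ℂ)
  have hc : c ≠ 0 := Nat.cast_ne_zero.2 (Nat.factorial_ne_zero _)
  have hpq : p * q = 1 := by
    rw [tensorMatrix_mul, ← tensorMatrix_one]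
    congr 1
    ext1 i
    exact hPQ
  have hBB : Bᵀ * B = c • 1 := transpose_mul_antisymBasis
  have hp : Bᵀ * p * (B * Bᵀ) = c • (Bᵀ * p) := by
    rw [Matrix.mul_assoc, antisymBasis_mul_transpose, ← antisym_mul_tensorMatrix,
      ← antisymBasis_mul_transpose, ← Matrix.mul_assoc, ← Matrix.mul_assoc]
    change Bᵀ * B * Bᵀ * p = _
    rw [hBB]
    simp
  have hq : B * Bᵀ * (q * B) = c • (q * B) := by
    rw [← Matrix.mul_assoc, antisymBasis_mul_transpose, antisym_mul_tensorMatrix,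
      ← antisymBasis_mul_transpose, Matrix.mul_assoc, Matrix.mul_assoc]
    change q * (B * (Bᵀ * B)) = _
    rw [hBB]
    simp
  have h1 : (Bᵀ * p * B) * (Bᵀ * q * B) = (c * c) • 1 := by
    calc _ = (Bᵀ * p * (B * Bᵀ)) * (q * B) := by simp only [Matrix.mul_assoc]
      _ = c • (Bᵀ * (p * q) * B) := by rw [hp]; simp only [Matrix.mul_assoc, Matrix.smul_mul]
      _ = _ := by rw [hpq, Matrix.mul_one, hBB, smul_smul]
  have h2 : (Bᵀ * p * B) * (Bᵀ * K * B) * (Bᵀ * q * B) =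
      (c * c) • (Bᵀ * (p * K * q) * B) := by
    calc _ = (Bᵀ * p * (B * Bᵀ)) * K * (B * Bᵀ * (q * B)) := by simp only [Matrix.mul_assoc]
      _ = _ := by
        rw [hp, hq]
        simp only [Matrix.mul_assoc, Matrix.smul_mul, Matrix.mul_smul, smul_smul]
  have h1' := congrArg det h1
  have h2' := congrArg det h2
  rw [det_mul, det_smul, det_one, mul_one] at h1'
  rw [det_mul, det_mul, det_smul, mul_right_comm, h1'] at h2'
  exact (mul_left_cancel₀ (pow_ne_zero _ (mul_ne_zero hc hc)) h2').symm

theorem sum_perm_apply_zero (g : Fin (m + 1) → ℂ) :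
    ∑ π : Equiv.Perm (Fin (m + 1)), g (π 0) = m.factorial * ∑ i, g i := by
  rw [← Equiv.sum_comp Equiv.Perm.decomposeFin.symm, Fintype.sum_prod_type]
  simp [Fintype.card_perm, Finset.mul_sum]

/-- The operator on words acting by `M` on the first letter. -/
def firstLetterMatrix (m : ℕ) (M : Matrix (Fin n) (Fin n) ℂ) :
    Matrix (Fin (m + 1) → Fin n) (Fin (m + 1) → Fin n) ℂ :=
  tensorMatrix (Fin.cons M 1)

theorem det_compress_firstLetterMatrix {P Q : Matrix (Fin n) (Fin n) ℂ} (hPQ : P * Q = 1)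
    (x : Fin n → ℂ) :
    ((antisymBasis n (m + 1))ᵀ * firstLetterMatrix m (P * diagonal x * Q) *
      antisymBasis n (m + 1)).det =
    (m.factorial : ℂ) ^ Fintype.card {S : Finset (Fin n) // S.card = m + 1} *
      ∏ S : {S : Finset (Fin n) // S.card = m + 1}, ∑ i ∈ S.1, x i := by
  have h1 : firstLetterMatrix m (P * diagonal x * Q) = tensorMatrix (fun _ => P) *
      firstLetterMatrix m (diagonal x) * tensorMatrix (fun _ => Q) := by
    rw [firstLetterMatrix, firstLetterMatrix, tensorMatrix_mul, tensorMatrix_mul]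
    congr 1
    ext1 i
    refine Fin.cases ?_ (fun i => ?_) i
    · rfl
    · simp [hPQ]
  have h2 : firstLetterMatrix m (diagonal x) = diagonal fun a => x (a 0) := by
    ext a b
    simp only [firstLetterMatrix, tensorMatrix, of_apply, Fin.prod_univ_succ, Fin.cons_zero,
      Fin.cons_succ, Pi.one_apply, one_apply, diagonal_apply, Finset.prod_ite_zero,
      _root_.funext_iff, Fin.forall_fin_succ]
    by_cases h : a 0 = b 0 <;> simp [h]
  rw [h1, det_compress_conj hPQ, h2, antisymBasis_compress_diagonal, det_diagonal,
    ← Finset.card_univ, ← Finset.prod_const, ← Finset.prod_mul_distrib]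
  refine Finset.prod_congr rfl fun S _ => ?_
  rw [← sum_sortedWord, ← sum_perm_apply_zero fun i => x (sortedWord S i)]
  rfl

theorem compress_firstLetterMatrix_apply (M : Matrix (Fin n) (Fin n) ℂ)
    (T S : {S : Finset (Fin n) // S.card = m + 1}) :
    ((antisymBasis n (m + 1))ᵀ * firstLetterMatrix m M * antisymBasis n (m + 1)) T S =
      ∑ u : Fin m → Fin n, ∑ p, ∑ q, antisymBasis n (m + 1) (Fin.cons p u) T * M p q *
        antisymBasis n (m + 1) (Fin.cons q u) S := by
  have hsum : ∀ F : (Fin (m + 1) → Fin n) → ℂ,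
      ∑ a, F a = ∑ p, ∑ u : Fin m → Fin n, F (Fin.cons p u) := by
    intro F
    rw [← Equiv.sum_comp (Fin.consEquiv fun _ => Fin n), Fintype.sum_prod_type]
    rfl
  have hK : ∀ p q (u w : Fin m → Fin n), firstLetterMatrix m M (Fin.cons p u) (Fin.cons q w) =
      if u = w then M p q else 0 := by
    intro p q u w
    simp only [firstLetterMatrix, tensorMatrix, of_apply, Fin.prod_univ_succ, Fin.cons_zero,
      Fin.cons_succ, Pi.one_apply, one_apply, Finset.prod_ite_zero, _root_.funext_iff]
    simp
  simp only [mul_apply, hsum, hK, transpose_apply, mul_ite, mul_zero, Finset.sum_mul, ite_mul,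
    zero_mul, Finset.sum_ite_eq', Finset.mem_univ, if_true]
  exact sum_comm_triple _

end Antisymmetrizer

section Determinant

open Matrix

variable {ι U Y : Type} [Fintype ι] [DecidableEq ι] [Fintype U] [Fintype Y]

theorem sum_perm_sum_perm_sign_prod (A : Matrix ι ι ℂ) :
    ∑ π : Equiv.Perm ι, ∑ ρ : Equiv.Perm ι, ((Equiv.Perm.sign π : ℤ) : ℂ) *
      ((Equiv.Perm.sign ρ : ℤ) : ℂ) * ∏ s, A (π s) (ρ s) =
      (Fintype.card ι).factorial * A.det := by
  have h : ∀ π : Equiv.Perm ι, ∑ ρ : Equiv.Perm ι, ((Equiv.Perm.sign π : ℤ) : ℂ) *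
      ((Equiv.Perm.sign ρ : ℤ) : ℂ) * ∏ s, A (π s) (ρ s) = A.det := by
    intro π
    have h1 := det_permute π A
    rw [← det_transpose, det_apply'] at h1
    simp only [mul_assoc, ← Finset.mul_sum]
    simp only [transpose_apply, submatrix_apply, id] at h1
    rw [h1]
    linear_combination A.det * sign_mul_self π
  simp only [h]
  simp [Fintype.card_perm]

/-- The determinant of a compression, as a positive semidefinite form. -/
theorem factorial_mul_det_eq_sum (J : Y → U → ι → ℂ) (M : Matrix Y Y ℂ) :
    ((Fintype.card ι).factorial : ℂ) *
      (of fun T S => ∑ u, ∑ p, ∑ q, J p u T * M p q * J q u S : Matrix ι ι ℂ).det =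
      ∑ u : ι → U, ∑ a : ι → Y, ∑ b : ι → Y, (of fun s T => J (a s) (u s) T : Matrix ι ι ℂ).det *
        (of fun s T => J (b s) (u s) T : Matrix ι ι ℂ).det * ∏ s, M (a s) (b s) := by
  have hdet : ∀ (u : ι → U) (a : ι → Y), (of fun s T => J (a s) (u s) T : Matrix ι ι ℂ).det =
      ∑ π : Equiv.Perm ι, ((Equiv.Perm.sign π : ℤ) : ℂ) * ∏ s, J (a s) (u s) (π s) := by
    intro u a
    rw [← det_transpose, det_apply']
    rfl
  rw [← sum_perm_sum_perm_sign_prod]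
  simp only [of_apply, Finset.prod_univ_sum, Fintype.piFinset_univ, hdet]
  have hexp : ∀ (u : ι → U) (a b : ι → Y),
      (∑ π : Equiv.Perm ι, ((Equiv.Perm.sign π : ℤ) : ℂ) * ∏ s, J (a s) (u s) (π s)) *
        (∑ ρ : Equiv.Perm ι, ((Equiv.Perm.sign ρ : ℤ) : ℂ) * ∏ s, J (b s) (u s) (ρ s)) *
          ∏ s, M (a s) (b s) =
      ∑ π : Equiv.Perm ι, ∑ ρ : Equiv.Perm ι, ((Equiv.Perm.sign π : ℤ) : ℂ) *
        ((Equiv.Perm.sign ρ : ℤ) : ℂ) *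
          ∏ s, (J (a s) (u s) (π s) * M (a s) (b s) * J (b s) (u s) (ρ s)) := by
    intro u a b
    rw [Finset.sum_mul_sum, Finset.sum_mul]
    refine Finset.sum_congr rfl fun π _ => ?_
    rw [Finset.sum_mul]
    refine Finset.sum_congr rfl fun ρ _ => ?_
    simp only [Finset.prod_mul_distrib]
    ring
  simp only [hexp]
  simp only [Finset.mul_sum]
  have hcomm : ∀ F : Equiv.Perm ι → (ι → U) → (ι → Y) → (ι → Y) → ℂ,
      ∑ ρ, ∑ u, ∑ a, ∑ b, F ρ u a b = ∑ u, ∑ a, ∑ b, ∑ ρ, F ρ u a b :=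
    fun F => Finset.sum_comm.trans (Finset.sum_congr rfl fun u _ => sum_comm_triple _)
  exact (Finset.sum_congr rfl fun π _ => hcomm _).trans (hcomm _)

end Determinant

section BooleanProduct

open scoped ComplexOrder ComplexConjugate
open Matrix

variable {k m n : ℕ}

theorem booleanProd_eq_prod_subtype :
    booleanProd n k = ∏ S : {S : Finset (Fin n) // S.card = k}, ∑ i ∈ S.1, X i :=
  Finset.prod_subtype _ (by simp [Finset.mem_powersetCard]) _

theorem card_subsets : Fintype.card {S : Finset (Fin n) // S.card = k} = n.choose k := by
  simp

theorem isSymmetric_booleanProd : (booleanProd n k).IsSymmetric := by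
  intro e
  simp only [booleanProd, map_prod, map_sum, rename_X]
  refine Finset.prod_equiv (Equiv.finsetCongr e) (fun S => ?_) fun S _ => ?_
  · simp [Finset.mem_powersetCard]
  · simp

theorem isHomogeneous_booleanProd : (booleanProd n k).IsHomogeneous (n.choose k) := by
  have h := IsHomogeneous.prod ((Finset.univ : Finset (Fin n)).powersetCard k)
    (fun S => ∑ i ∈ S, (X i : MvPolynomial (Fin n) ℚ)) (fun _ => 1)
    fun S _ => IsHomogeneous.sum _ _ _ fun i _ => isHomogeneous_X _ i
  simpa [booleanProd] using h

theorem exists_intCast_eq_schurCoeff (lam : Fin n → ℕ) :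
    ∃ z : ℤ, (z : ℚ) = schurCoeff lam (booleanProd n k) := by
  have hmap : booleanProd n k = map (Int.castRingHom ℚ)
      (∏ S ∈ (Finset.univ : Finset (Fin n)).powersetCard k, ∑ i ∈ S, X i) := by
    simp [booleanProd]
  rw [hmap, schurCoeff_eq_sum]
  simp only [coeff_map]
  exact ⟨∑ w : Equiv.Perm (Fin n), (Equiv.Perm.sign w : ℤ) *
      if ∀ i, 0 ≤ (lam i : ℤ) - i + w i then
        coeff (Finsupp.equivFunOnFinite.symm fun i => ((lam i : ℤ) - i + w i).toNat)
          (∏ S ∈ (Finset.univ : Finset (Fin n)).powersetCard k, ∑ i ∈ S, X i) else 0,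
    by push_cast; rfl⟩

/-- The class function on permutations of `k`-subsets corresponding to the Boolean product. -/
noncomputable def booleanChar (n k : ℕ)
    (σ : Equiv.Perm {S : Finset (Fin n) // S.card = k}) : ℚ :=
  ∑ lam ∈ partitions n (n.choose k), schurCoeff lam (booleanProd n k) * schurChar lam σ

theorem sum_booleanChar_mul_cyclePsum :
    ∑ σ, C (booleanChar n k σ) * cyclePsum n σ = ((n.choose k).factorial : MvPolynomial _ ℚ) *
      booleanProd n k := by
  conv_rhs => rw [eq_sum_schurCoeff_mul_schur isSymmetric_booleanProd
    (isHomogeneous_booleanProd (n := n) (k := k))]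
  simp only [booleanChar, map_sum, map_mul, Finset.sum_mul, Finset.mul_sum, mul_assoc]
  rw [Finset.sum_comm]
  refine Finset.sum_congr rfl fun lam hlam => ?_
  rw [← Finset.mul_sum, sum_schurChar_mul_cyclePsum lam
    (by rw [card_subsets]; exact (mem_partitions.1 hlam).2), card_subsets]
  exact mul_left_comm _ _ _

theorem sum_booleanChar_mul_schurChar {mu : Fin n → ℕ} (hmu : mu ∈ partitions n (n.choose k)) :
    ∑ σ, booleanChar n k σ * schurChar mu σ =
      (n.choose k).factorial * schurCoeff mu (booleanProd n k) := by
  simp only [booleanChar, Finset.sum_mul, mul_assoc]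
  rw [Finset.sum_comm]
  have h : ∀ lam ∈ partitions n (n.choose k), ∑ σ : Equiv.Perm {S : Finset (Fin n) // S.card = k},
      schurCoeff lam (booleanProd n k) * (schurChar lam σ * schurChar mu σ) =
      if lam = mu then (n.choose k).factorial * schurCoeff mu (booleanProd n k) else 0 := by
    intro lam hlam
    rw [← Finset.mul_sum, sum_schurChar_mul_schurChar (by rwa [card_subsets])
      (by rwa [card_subsets]), card_subsets]
    split_ifs with h
    · rw [h]
      ring
    · simp
  rw [Finset.sum_congr rfl h, Finset.sum_ite_eq', if_pos hmu]

/-- The coefficient matrix exhibiting the Boolean product as a positive semidefinite form. -/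
noncomputable def booleanFactor (n m : ℕ)
    (u : {S : Finset (Fin n) // S.card = m + 1} → Fin m → Fin n)
    (a : {S : Finset (Fin n) // S.card = m + 1} → Fin n) : ℂ :=
  (of fun s T => antisymBasis n (m + 1) (Fin.cons (a s) (u s)) T).det

theorem conj_antisymBasis (a : Fin k → Fin n) (S : {S : Finset (Fin n) // S.card = k}) :
    conj (antisymBasis n k a S) = antisymBasis n k a S := by
  simp [antisymBasis, antisym, apply_ite]

theorem conj_booleanFactor (u : {S : Finset (Fin n) // S.card = m + 1} → Fin m → Fin n)
    (a : {S : Finset (Fin n) // S.card = m + 1} → Fin n) :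
    conj (booleanFactor n m u a) = booleanFactor n m u a := by
  rw [booleanFactor, RingHom.map_det]
  congr 1
  ext s T
  exact conj_antisymBasis _ _

theorem sum_booleanFactor_eq (M : Matrix (Fin n) (Fin n) ℂ) (hM : M.IsHermitian) :
    ∑ u, ∑ a, ∑ b, booleanFactor n m u a * booleanFactor n m u b * ∏ s, M (a s) (b s) =
      (((m.factorial : ℝ) ^ n.choose (m + 1) : ℝ) : ℂ) *
        ∑ σ, (booleanChar n (m + 1) σ : ℂ) *
          ∑ a : {S : Finset (Fin n) // S.card = m + 1} → Fin n, ∏ s, M (a s) (a (σ s)) := by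
  let P : Matrix (Fin n) (Fin n) ℂ := hM.eigenvectorUnitary
  let Q : Matrix (Fin n) (Fin n) ℂ := star P
  let x : Fin n → ℂ := fun i => hM.eigenvalues i
  have hPQ : P * Q = 1 := Unitary.coe_mul_star_self _
  have hQP : Q * P = 1 := Unitary.coe_star_mul_self _
  have hMx : M = P * diagonal x * Q := hM.spectral_theorem
  have hdet := factorial_mul_det_eq_sum
    (fun p u T => antisymBasis n (m + 1) (Fin.cons p u) T) M
  have hΦ : (of fun T S => ∑ u : Fin m → Fin n, ∑ p, ∑ q,
      antisymBasis n (m + 1) (Fin.cons p u) T * M p q *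
        antisymBasis n (m + 1) (Fin.cons q u) S : Matrix _ _ ℂ) =
      (antisymBasis n (m + 1))ᵀ * firstLetterMatrix m M * antisymBasis n (m + 1) := by
    ext T S
    exact (compress_firstLetterMatrix_apply M T S).symm
  refine hdet.symm.trans ?_
  rw [hΦ, hMx, det_compress_firstLetterMatrix hPQ]
  simp only [sum_prod_perm_of_diagonalization hQP, card_subsets]
  have h := congrArg (eval₂ (algebraMap ℚ ℂ) x)
    (sum_booleanChar_mul_cyclePsum (n := n) (k := m + 1))
  simp only [eval₂_sum, eval₂_mul, eval₂_C, cyclePsum, eval₂_prod, eval₂_X, eval₂_natCast,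
    booleanProd_eq_prod_subtype, eq_ratCast] at h
  rw [h]
  push_cast
  ring

theorem schurCoeff_booleanProd_nonneg {mu : Fin n → ℕ}
    (hmu : mu ∈ partitions n (n.choose (m + 1))) :
    0 ≤ schurCoeff mu (booleanProd n (m + 1)) := by
  have hconst := isConstituent_schurChar (ι := {S : Finset (Fin n) // S.card = m + 1}) (lam := mu)
    (by rwa [card_subsets])
  have h := hconst.sum_mul_nonneg (fun σ => (booleanChar n (m + 1) σ : ℂ)) fun z v hv hz =>
    eigenvalue_nonneg_of_form_eq (booleanFactor n m) conj_booleanFactor _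
      (fun σ τ => by simp only [booleanChar, schurChar_conj])
      (r := (m.factorial : ℝ) ^ n.choose (m + 1)) (by positivity) sum_booleanFactor_eq z v hv hz
  have h' : (0 : ℂ) ≤ ((∑ σ, booleanChar n (m + 1) σ * schurChar mu σ : ℚ) : ℝ) := by
    push_cast
    exact h
  rw [Complex.zero_le_real, Rat.cast_nonneg, sum_booleanChar_mul_schurChar hmu] at h'
  exact nonneg_of_mul_nonneg_right h' (by positivity)

end BooleanProduct

end BooleanSchur

theorem stmt0 (n k : ℕ) (hk : 1 ≤ k) (hkn : k ≤ n) :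
    ∃ (P : Finset (Fin n → ℕ)) (κ : (Fin n → ℕ) → ℕ),
      (∀ lam ∈ P, Antitone lam ∧ ∑ i, lam i = n.choose k) ∧
      booleanProd n k = ∑ lam ∈ P, (κ lam : MvPolynomial (Fin n) ℚ) * schur n lam := by
  obtain ⟨m, rfl⟩ := Nat.exists_eq_add_of_le' hk
  choose z hz using fun lam : Fin n → ℕ =>
    BooleanSchur.exists_intCast_eq_schurCoeff (k := m + 1) lam
  refine ⟨BooleanSchur.partitions n (n.choose (m + 1)), fun lam => (z lam).toNat,
    fun lam hlam => BooleanSchur.mem_partitions.1 hlam, ?_⟩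
  refine (BooleanSchur.eq_sum_schurCoeff_mul_schur BooleanSchur.isSymmetric_booleanProd
    BooleanSchur.isHomogeneous_booleanProd).trans (Finset.sum_congr rfl fun lam hlam => ?_)
  have hnonneg : 0 ≤ z lam := by
    have h := BooleanSchur.schurCoeff_booleanProd_nonneg hlam
    rw [← hz] at h
    exact_mod_cast h
  have hcast : BooleanSchur.schurCoeff lam (booleanProd n (m + 1)) = ((z lam).toNat : ℚ) := by
    rw [← hz]
    exact_mod_cast (Int.toNat_of_nonneg hnonneg).symm
  rw [hcast, map_natCast]
end

section
/- The total Boolean product polynomial B_n(x_1,…,x_n) = ∏_{k=1}^{n} ∏_{S ⊆ [n], |S| = k} (∑_{i ∈ S} x_i) is Schur-positive: there exist nonnegative integers c_λ, indexed by partitions λ of 2^n − 1 with at most n parts, such that B_n(x_1,…,x_n) = ∑_λ c_λ · s_λ(x_1,…,x_n). -/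
open MvPolynomial

/-- The `n`-th total Boolean product polynomial. -/
noncomputable def totalBooleanProd (n : ℕ) : MvPolynomial (Fin n) ℚ :=
  ∏ k ∈ Finset.Icc 1 n, booleanProd n k

variable {n : ℕ}

theorem derivation_intertwine {σ A : Type*} [CommRing A] [Algebra ℚ A]
    (φ : MvPolynomial σ ℚ →ₐ[ℚ] A) (D : Derivation ℚ (MvPolynomial σ ℚ) (MvPolynomial σ ℚ))
    (D' : Derivation ℚ A A) (h : ∀ s, D' (φ (X s)) = φ (D (X s))) (p : MvPolynomial σ ℚ) :
    D' (φ p) = φ (D p) := by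
  induction p using MvPolynomial.induction_on with
  | C a => simp [← MvPolynomial.algebraMap_eq]
  | add p q hp hq => simp [hp, hq]
  | mul_X p s hp => simp [hp, h]

/-- The infinitesimal left translation `∑ₖ z_{ik} ∂/∂z_{jk}` on functions of a matrix `z`. -/
noncomputable def leftDer (i j : Fin n) :
    Derivation ℚ (MvPolynomial (Fin n × Fin n) ℚ) (MvPolynomial (Fin n × Fin n) ℚ) :=
  mkDerivation ℚ fun p => if j = p.1 then X (i, p.2) else 0

/-- The infinitesimal right translation `∑ₖ z_{ki} ∂/∂z_{kj}` on functions of a matrix `z`. -/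
noncomputable def rightDer (i j : Fin n) :
    Derivation ℚ (MvPolynomial (Fin n × Fin n) ℚ) (MvPolynomial (Fin n × Fin n) ℚ) :=
  mkDerivation ℚ fun p => if j = p.2 then X (p.1, i) else 0

/-- Left translation of the first of two matrices. -/
noncomputable def leftDerFst (i j : Fin n) :
    Derivation ℚ (MvPolynomial (Fin n × Fin n ⊕ Fin n × Fin n) ℚ)
      (MvPolynomial (Fin n × Fin n ⊕ Fin n × Fin n) ℚ) :=
  mkDerivation ℚ (Sum.elim (fun p => if j = p.1 then X (Sum.inl (i, p.2)) else 0) fun _ => 0)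

/-- Left translation of the second of two matrices. -/
noncomputable def leftDerSnd (i j : Fin n) :
    Derivation ℚ (MvPolynomial (Fin n × Fin n ⊕ Fin n × Fin n) ℚ)
      (MvPolynomial (Fin n × Fin n ⊕ Fin n × Fin n) ℚ) :=
  mkDerivation ℚ (Sum.elim (fun _ => 0) fun p => if j = p.1 then X (Sum.inr (i, p.2)) else 0)

/-- Substitution of `z wᵀ` for the matrix variable. -/
noncomputable def kernelHom (n : ℕ) :
    MvPolynomial (Fin n × Fin n) ℚ →ₐ[ℚ] MvPolynomial (Fin n × Fin n ⊕ Fin n × Fin n) ℚ :=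
  aeval fun p => ∑ k, X (Sum.inl (p.1, k)) * X (Sum.inr (p.2, k))

/-- Restriction of a function of matrices to diagonal matrices. -/
noncomputable def diagRes (n : ℕ) : MvPolynomial (Fin n × Fin n) ℚ →ₐ[ℚ] MvPolynomial (Fin n) ℚ :=
  aeval fun p => if p.1 = p.2 then X p.1 else 0

theorem leftDer_X (i j k l : Fin n) :
    leftDer i j (X (k, l)) = if j = k then X (i, l) else 0 := by
  simp [leftDer, mkDerivation_X]

theorem rightDer_X (i j k l : Fin n) :
    rightDer i j (X (k, l)) = if j = l then X (k, i) else 0 := by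
  simp [rightDer, mkDerivation_X]

theorem leftDer_rightDer_comm (i j k l : Fin n) (p : MvPolynomial (Fin n × Fin n) ℚ) :
    leftDer i j (rightDer k l p) = rightDer k l (leftDer i j p) := by
  have : ⁅leftDer i j, rightDer k l⁆ = 0 := by
    apply MvPolynomial.derivation_ext
    rintro ⟨a, b⟩
    simp only [Derivation.commutator_apply, leftDer_X, rightDer_X, Derivation.coe_zero,
      Pi.zero_apply]
    split_ifs <;> simp_all [leftDer_X, rightDer_X]
  have := DFunLike.congr_fun this p
  rw [Derivation.commutator_apply] at this
  simpa [sub_eq_zero] using this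

theorem leftDer_leftDer (i j k l : Fin n) (p : MvPolynomial (Fin n × Fin n) ℚ) :
    leftDer i j (leftDer k l p) = leftDer k l (leftDer i j p)
      + (if j = k then leftDer i l p else 0) - (if l = i then leftDer k j p else 0) := by
  have : ⁅leftDer i j, leftDer k l⁆ =
      (if j = k then leftDer i l else 0) - (if l = i then leftDer k j else 0) := by
    apply MvPolynomial.derivation_ext
    rintro ⟨a, b⟩
    rw [Derivation.commutator_apply]
    by_cases h1 : l = a <;> by_cases h2 : j = k <;> by_cases h3 : l = i <;> by_cases h4 : j = a <;>
      simp_all [leftDer_X]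
  have := DFunLike.congr_fun this p
  rw [Derivation.commutator_apply] at this
  rw [sub_eq_iff_eq_add'.mp this, add_sub_assoc]
  split_ifs <;> simp

theorem leftDerFst_kernelHom (i j : Fin n) (p : MvPolynomial (Fin n × Fin n) ℚ) :
    leftDerFst i j (kernelHom n p) = kernelHom n (leftDer i j p) := by
  apply derivation_intertwine
  rintro ⟨k, l⟩
  rw [leftDer_X]
  by_cases h : j = k <;> simp [kernelHom, leftDerFst, mkDerivation_X, h, mul_comm]

theorem leftDerSnd_kernelHom (i j : Fin n) (p : MvPolynomial (Fin n × Fin n) ℚ) :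
    leftDerSnd i j (kernelHom n p) = kernelHom n (rightDer i j p) := by
  apply derivation_intertwine
  rintro ⟨k, l⟩
  rw [rightDer_X]
  by_cases h : j = l <;> simp [kernelHom, leftDerSnd, mkDerivation_X, h]

theorem leftDerFst_mul (i j : Fin n) (p q : MvPolynomial (Fin n × Fin n) ℚ) :
    leftDerFst i j (rename Sum.inl p * rename Sum.inr q) =
      rename Sum.inl (leftDer i j p) * rename Sum.inr q := by
  have h1 : leftDerFst i j (rename Sum.inl p) = rename Sum.inl (leftDer i j p) := by
    apply derivation_intertwine
    rintro ⟨k, l⟩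
    rw [leftDer_X]
    by_cases h : j = k <;> simp [leftDerFst, mkDerivation_X, h]
  have h2 : leftDerFst i j (rename Sum.inr q) = rename Sum.inr
      ((0 : Derivation ℚ (MvPolynomial (Fin n × Fin n) ℚ) (MvPolynomial (Fin n × Fin n) ℚ)) q) := by
    apply derivation_intertwine
    rintro ⟨k, l⟩
    simp [leftDerFst, mkDerivation_X]
  simp [h1, h2, mul_comm]

theorem leftDerSnd_mul (i j : Fin n) (p q : MvPolynomial (Fin n × Fin n) ℚ) :
    leftDerSnd i j (rename Sum.inl p * rename Sum.inr q) =
      rename Sum.inl p * rename Sum.inr (leftDer i j q) := by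
  have h1 : leftDerSnd i j (rename Sum.inr q) = rename Sum.inr (leftDer i j q) := by
    apply derivation_intertwine
    rintro ⟨k, l⟩
    rw [leftDer_X]
    by_cases h : j = k <;> simp [leftDerSnd, mkDerivation_X, h]
  have h2 : leftDerSnd i j (rename Sum.inl p) = rename Sum.inl
      ((0 : Derivation ℚ (MvPolynomial (Fin n × Fin n) ℚ) (MvPolynomial (Fin n × Fin n) ℚ)) p) := by
    apply derivation_intertwine
    rintro ⟨k, l⟩
    simp [leftDerSnd, mkDerivation_X]
  simp [h1, h2]

/-- The quadratic Casimir operator of `gl_n`, shifted by a multiple of the Euler operator, built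
from operators `D i j` representing the matrix units. -/
noncomputable def casimir {A : Type*} [CommRing A] [Algebra ℚ A]
    (D : Fin n → Fin n → Derivation ℚ A A) : A →ₗ[ℚ] A :=
  ∑ i, ∑ j, (D i j).toLinearMap ∘ₗ (D j i).toLinearMap +
    ((n : ℚ) - 1) • ∑ i, (D i i).toLinearMap

theorem casimir_apply {A : Type*} [CommRing A] [Algebra ℚ A]
    (D : Fin n → Fin n → Derivation ℚ A A) (a : A) :
    casimir D a = ∑ i, ∑ j, D i j (D j i a) + ((n : ℚ) - 1) • ∑ i, D i i a := by
  simp [casimir]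

theorem casimir_map {A B : Type*} [CommRing A] [Algebra ℚ A] [CommRing B] [Algebra ℚ B]
    (D : Fin n → Fin n → Derivation ℚ A A) (D' : Fin n → Fin n → Derivation ℚ B B)
    (φ : A →ₗ[ℚ] B) (h : ∀ i j a, D' i j (φ a) = φ (D i j a)) (a : A) :
    casimir D' (φ a) = φ (casimir D a) := by
  simp [casimir_apply, h]

/-- Infinitesimal invariance under conjugation. -/
def IsClassFunction (G : MvPolynomial (Fin n × Fin n) ℚ) : Prop :=
  ∀ i j, leftDer i j G = rightDer j i G

theorem leftDer_casimir (a b : Fin n) (p : MvPolynomial (Fin n × Fin n) ℚ) :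
    leftDer a b (casimir leftDer p) = casimir leftDer (leftDer a b p) := by
  have h1 : ∀ i j, leftDer a b (leftDer i j (leftDer j i p)) =
      leftDer i j (leftDer j i (leftDer a b p))
      + ((if b = i then leftDer a j (leftDer j i p) else 0)
        - (if a = i then leftDer i j (leftDer j b p) else 0))
      + ((if b = j then leftDer i j (leftDer a i p) else 0)
        - (if a = j then leftDer i b (leftDer j i p) else 0)) := by
    intro i j
    rw [leftDer_leftDer a b i j, leftDer_leftDer a b j i]
    simp only [eq_comm (a := a)]
    split_ifs <;> simp <;> ring
  have h2 : ∀ i, leftDer a b (leftDer i i p) = leftDer i i (leftDer a b p)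
      + ((if b = i then leftDer a i p else 0) - (if a = i then leftDer i b p else 0)) := by
    intro i
    rw [leftDer_leftDer a b i i]
    simp only [eq_comm (a := a)]
    ring
  simp only [casimir_apply, map_add, map_sum, Derivation.map_smul, h1, h2, Finset.sum_add_distrib,
    Finset.sum_sub_distrib]
  simp only [Finset.sum_ite_irrel, Finset.sum_ite_eq, Finset.mem_univ, if_true,
    Finset.sum_const_zero, sub_self, add_zero]

theorem IsClassFunction.casimir_right {G : MvPolynomial (Fin n × Fin n) ℚ}
    (hG : IsClassFunction G) : casimir rightDer G = casimir leftDer G := by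
  have h (i j : Fin n) : rightDer i j (rightDer j i G) = leftDer i j (leftDer j i G) := by
    rw [← hG i j, ← leftDer_rightDer_comm, ← hG j i]
  simp only [casimir_apply, h]
  simp only [hG _ _]

theorem rightDer_casimir (a b : Fin n) (p : MvPolynomial (Fin n × Fin n) ℚ) :
    rightDer a b (casimir leftDer p) = casimir leftDer (rightDer a b p) := by
  simp [casimir_apply, leftDer_rightDer_comm]

theorem IsClassFunction.map_casimir {G : MvPolynomial (Fin n × Fin n) ℚ}
    (hG : IsClassFunction G) : IsClassFunction (casimir leftDer G) := by
  intro i j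
  rw [leftDer_casimir, rightDer_casimir, hG i j]

theorem IsClassFunction.sub_smul {G H : MvPolynomial (Fin n × Fin n) ℚ}
    (hG : IsClassFunction G) (hH : IsClassFunction H) (t : ℚ) : IsClassFunction (G - t • H) := by
  intro i j
  simp [hG i j, hH i j]

/-- The function `G (z wᵀ)` is a nonnegative combination of products `d(z) d(w)`. -/
def HasPosKernel (G : MvPolynomial (Fin n × Fin n) ℚ) : Prop :=
  ∃ (ι : Type) (_ : Fintype ι) (d : ι → MvPolynomial (Fin n × Fin n) ℚ) (k : ℚ), 0 ≤ k ∧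
    kernelHom n G = k • ∑ c, rename Sum.inl (d c) * rename Sum.inr (d c)

/-- The Casimir operator shifted by a scalar. -/
noncomputable def casimirSub {A : Type*} [CommRing A] [Algebra ℚ A]
    (D : Fin n → Fin n → Derivation ℚ A A) (t : ℚ) : A →ₗ[ℚ] A :=
  casimir D - t • LinearMap.id

theorem IsClassFunction.map_casimirSub {G : MvPolynomial (Fin n × Fin n) ℚ}
    (hG : IsClassFunction G) (t : ℚ) : IsClassFunction (casimirSub leftDer t G) :=
  hG.map_casimir.sub_smul hG t

theorem HasPosKernel.map_casimirSub_casimirSub {G : MvPolynomial (Fin n × Fin n) ℚ}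
    (hG : IsClassFunction G) (hk : HasPosKernel G) (t : ℚ) :
    HasPosKernel (casimirSub leftDer t (casimirSub leftDer t G)) := by
  obtain ⟨ι, _, d, k, hk0, hk⟩ := hk
  refine ⟨ι, inferInstance, fun c => casimirSub leftDer t (d c), k, hk0, ?_⟩
  have e1 (p) : casimir leftDerFst (kernelHom n p) = kernelHom n (casimir leftDer p) :=
    casimir_map _ _ (kernelHom n).toLinearMap leftDerFst_kernelHom p
  have e2 (p) : casimir leftDerSnd (kernelHom n p) = kernelHom n (casimir rightDer p) :=
    casimir_map _ _ (kernelHom n).toLinearMap leftDerSnd_kernelHom p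
  have f1 (p q : MvPolynomial (Fin n × Fin n) ℚ) :
      casimir leftDerFst (rename Sum.inl p * rename Sum.inr q) =
      rename Sum.inl (casimir leftDer p) * rename Sum.inr q :=
    casimir_map leftDer leftDerFst ((LinearMap.mulRight ℚ (rename Sum.inr q)).comp
      (rename Sum.inl).toLinearMap) (fun i j a => leftDerFst_mul i j a q) p
  have f2 (p q : MvPolynomial (Fin n × Fin n) ℚ) :
      casimir leftDerSnd (rename Sum.inl p * rename Sum.inr q) =
      rename Sum.inl p * rename Sum.inr (casimir leftDer q) :=
    casimir_map leftDer leftDerSnd ((LinearMap.mulLeft ℚ (rename Sum.inl p)).comp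
      (rename Sum.inr).toLinearMap) (fun i j a => leftDerSnd_mul i j p a) q
  have k1 : kernelHom n (casimirSub leftDer t (casimirSub leftDer t G)) =
      casimirSub leftDerFst t (kernelHom n (casimirSub leftDer t G)) := by
    simp [casimirSub, e1]
  have k2 : kernelHom n (casimirSub leftDer t G) =
      casimirSub leftDerSnd t (kernelHom n G) := by
    simp [casimirSub, e2, hG.casimir_right]
  rw [k1, k2, hk]
  simp only [map_smul, map_sum]
  congr 1
  refine Finset.sum_congr rfl fun c _ => ?_
  simp only [casimirSub, LinearMap.sub_apply, LinearMap.smul_apply, LinearMap.id_apply, f2,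
    map_sub, map_smul, f1]
  simp only [MvPolynomial.smul_eq_C_mul]
  ring

/-- The Euler operator `xᵢ ∂/∂xᵢ`. -/
noncomputable def eulerDer (i : Fin n) :
    Derivation ℚ (MvPolynomial (Fin n) ℚ) (MvPolynomial (Fin n) ℚ) :=
  mkDerivation ℚ fun j => if i = j then X i else 0

theorem eulerDer_X (i j : Fin n) : eulerDer i (X j) = if i = j then X i else 0 := by
  simp [eulerDer, mkDerivation_X]

theorem eulerDer_monomial (i : Fin n) (ν : Fin n →₀ ℕ) (a : ℚ) :
    eulerDer i (monomial ν a) = (ν i : ℚ) • monomial ν a := by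
  rw [eulerDer, mkDerivation_monomial, Finsupp.sum_fintype _ _ (by simp)]
  rw [Finset.sum_eq_single i]
  · by_cases h : ν i = 0
    · simp [h]
    · have h' : ν - Finsupp.single i 1 + Finsupp.single i 1 = ν :=
        tsub_add_cancel_of_le (by simpa [Nat.one_le_iff_ne_zero] using h)
      simp only [if_true, smul_eq_mul, X, monomial_mul, h', smul_monomial]
      congr 1
      ring
  · intro j _ hj
    simp [hj.symm]
  · simp

theorem coeff_eulerDer (i : Fin n) (ν : Fin n →₀ ℕ) (p : MvPolynomial (Fin n) ℚ) :
    coeff ν (eulerDer i p) = ν i * coeff ν p := by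
  induction p using MvPolynomial.induction_on' with
  | monomial μ a =>
    rw [eulerDer_monomial, coeff_smul, coeff_monomial]
    split_ifs with h <;> simp [h]
  | add p q hp hq => simp [hp, hq, mul_add]

theorem diagRes_X (k l : Fin n) : diagRes n (X (k, l)) = if k = l then X k else 0 := by
  simp [diagRes]

theorem diagRes_leftDer_self (i : Fin n) (p : MvPolynomial (Fin n × Fin n) ℚ) :
    diagRes n (leftDer i i p) = eulerDer i (diagRes n p) := by
  symm
  apply derivation_intertwine
  rintro ⟨k, l⟩
  rw [leftDer_X]
  by_cases h : k = l <;> by_cases h' : i = k <;> simp_all [diagRes_X, eulerDer_X]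

theorem X_mul_diagRes_leftDer (i j : Fin n) (p : MvPolynomial (Fin n × Fin n) ℚ) :
    X j * diagRes n (leftDer i j p) = X i * diagRes n (rightDer j i p) := by
  induction p using MvPolynomial.induction_on with
  | C a => simp [← MvPolynomial.algebraMap_eq]
  | add p q hp hq => simp [mul_add, hp, hq]
  | mul_X p s hp =>
    obtain ⟨k, l⟩ := s
    have h : X j * diagRes n (leftDer i j (X (k, l))) =
        X i * diagRes n (rightDer j i (X (k, l))) := by
      rw [leftDer_X, rightDer_X]
      by_cases h : j = k <;> by_cases h' : i = l <;> simp_all [diagRes_X, mul_comm]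
      all_goals simp_all [eq_comm]
    simp only [Derivation.leibniz, smul_eq_mul, map_add, map_mul]
    linear_combination diagRes n p * h + diagRes n (X (k, l)) * hp

theorem IsClassFunction.diagRes_offDiag {G : MvPolynomial (Fin n × Fin n) ℚ}
    (hG : IsClassFunction G) (i j : Fin n) :
    (X i - X j) * (diagRes n (leftDer i j (leftDer j i G)) +
      diagRes n (leftDer j i (leftDer i j G))) =
    (X i + X j) * (eulerDer i (diagRes n G) - eulerDer j (diagRes n G)) := by
  have h1 := X_mul_diagRes_leftDer i j (leftDer j i G)
  rw [← leftDer_rightDer_comm, ← hG i j] at h1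
  have h2 := congrArg (diagRes n) (leftDer_leftDer i j j i G)
  simp only [if_true, map_sub, map_add, diagRes_leftDer_self] at h2
  linear_combination -2 * h1 + (X i + X j) * h2

/-- The Vandermonde product. -/
noncomputable def vdm (n : ℕ) : MvPolynomial (Fin n) ℚ :=
  ∏ i : Fin n, ∏ j ∈ Finset.Ioi i, (X i - X j)

/-- The staircase exponent `(n - 1, n - 2, …, 0)`. -/
def stair (n : ℕ) (i : Fin n) : ℕ := n - 1 - i

/-- The alternant `det (x_j ^ α_i)`. -/
noncomputable def alternant (α : Fin n → ℕ) : MvPolynomial (Fin n) ℚ :=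
  (Matrix.of fun i j : Fin n => (X j : MvPolynomial (Fin n) ℚ) ^ α i).det

theorem vdm_eq_alternant : vdm n = alternant (stair n) := by
  have := Matrix.det_projVandermonde (1 : Fin n → MvPolynomial (Fin n) ℚ) X
  simp only [Pi.one_apply, one_mul] at this
  rw [vdm, ← this, alternant, ← Matrix.det_transpose]
  congr 1
  ext i j : 2
  simp [Matrix.projVandermonde_apply, stair, Fin.val_rev, Nat.sub_sub, add_comm]

theorem alternant_eq_sum (α : Fin n → ℕ) : alternant α =
    ∑ w : Equiv.Perm (Fin n), ((Equiv.Perm.sign w : ℤ) : ℚ) •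
      monomial (Finsupp.equivFunOnFinite.symm (α ∘ w)) (1 : ℚ) := by
  rw [alternant, Matrix.det_apply]
  refine Finset.sum_congr rfl fun w _ => ?_
  rw [monomial_eq, Finsupp.prod_fintype _ _ (by simp)]
  simp [Units.smul_def, zsmul_eq_mul, smul_eq_C_mul]

theorem coeff_alternant_mul (α ν : Fin n → ℕ) (g : MvPolynomial (Fin n) ℚ) :
    coeff (Finsupp.equivFunOnFinite.symm ν) (alternant α * g) =
      ∑ w : Equiv.Perm (Fin n), ((Equiv.Perm.sign w : ℤ) : ℚ) *
        (if ∀ i, α (w i) ≤ ν i then coeff (Finsupp.equivFunOnFinite.symm (ν - α ∘ w)) g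
          else 0) := by
  rw [alternant_eq_sum, Finset.sum_mul, coeff_sum]
  refine Finset.sum_congr rfl fun w _ => ?_
  rw [smul_mul_assoc, coeff_smul, coeff_monomial_mul', smul_eq_mul, one_mul]
  congr 1
  exact if_congr Iff.rfl (congrArg (coeff · g) (by ext; rfl)) rfl

theorem sum_eulerDer_sq_alternant (α : Fin n → ℕ) :
    ∑ i, eulerDer i (eulerDer i (alternant α)) = (∑ i, (α i : ℚ) ^ 2) • alternant α := by
  rw [alternant_eq_sum]
  simp only [map_sum, Derivation.map_smul, eulerDer_monomial, Finset.smul_sum]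
  rw [Finset.sum_comm]
  refine Finset.sum_congr rfl fun w _ => ?_
  rw [← Equiv.sum_comp w (fun i => (α i : ℚ) ^ 2), Finset.sum_smul]
  refine Finset.sum_congr rfl fun i _ => ?_
  simp only [smul_smul, Finsupp.equivFunOnFinite_symm_apply_apply, Function.comp]
  congr 1
  ring

theorem derivation_prod {A ι : Type*} [CommRing A] [Algebra ℚ A] [DecidableEq ι]
    (D : Derivation ℚ A A) (s : Finset ι) (f : ι → A) :
    D (∏ i ∈ s, f i) = ∑ i ∈ s, (∏ j ∈ s.erase i, f j) * D (f i) := by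
  induction s using Finset.induction_on with
  | empty => simp
  | insert a s ha ih =>
    rw [Finset.prod_insert ha, Finset.sum_insert ha, Finset.erase_insert ha, Derivation.leibniz,
      ih, smul_eq_mul, smul_eq_mul, Finset.mul_sum, add_comm]
    congr 1
    refine Finset.sum_congr rfl fun i hi => ?_
    have hia : a ≠ i := fun h => ha (h ▸ hi)
    rw [Finset.erase_insert_of_ne hia, Finset.prod_insert (by simp [ha]), mul_assoc]

theorem eulerDer_vdm_mul_sum (g : Fin n → MvPolynomial (Fin n) ℚ) :
    ∃ b : Fin n → Fin n → MvPolynomial (Fin n) ℚ,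
      (∀ i, ∀ j ∈ Finset.Ioi i, vdm n = b i j * (X i - X j)) ∧
      ∑ k, eulerDer k (vdm n) * g k =
        ∑ i, ∑ j ∈ Finset.Ioi i, b i j * (X i * g i - X j * g j) := by
  classical
  let T : Finset (Σ _ : Fin n, Fin n) := Finset.univ.sigma fun i => Finset.Ioi i
  have hT : vdm n = ∏ p ∈ T, (X p.1 - X p.2) := by
    rw [vdm, Finset.prod_sigma]
  refine ⟨fun i j => ∏ p ∈ T.erase ⟨i, j⟩, (X p.1 - X p.2), ?_, ?_⟩
  · intro i j hj
    rw [hT, Finset.prod_erase_mul T (fun p => X p.1 - X p.2) (a := ⟨i, j⟩)]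
    simpa [T] using hj
  · rw [← Finset.sum_sigma (Finset.univ) (fun i => Finset.Ioi i) (fun p =>
      (∏ p ∈ T.erase p, (X p.1 - X p.2)) * (X p.1 * g p.1 - X p.2 * g p.2))]
    have h (k : Fin n) : eulerDer k (vdm n) =
        ∑ p ∈ T, (∏ q ∈ T.erase p, (X q.1 - X q.2)) * eulerDer k (X p.1 - X p.2) := by
      rw [hT, derivation_prod]
    simp only [h, Finset.sum_mul]
    rw [Finset.sum_comm]
    refine Finset.sum_congr rfl fun p _ => ?_
    simp only [mul_assoc, ← Finset.mul_sum]
    simp [eulerDer_X, sub_mul, ite_mul, Finset.sum_sub_distrib]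

theorem IsClassFunction.vdm_mul_diagRes_casimir {G : MvPolynomial (Fin n × Fin n) ℚ}
    (hG : IsClassFunction G) :
    vdm n * diagRes n (casimir leftDer G) =
      ∑ i, eulerDer i (eulerDer i (vdm n * diagRes n G)) -
        (∑ i, (stair n i : ℚ) ^ 2) • (vdm n * diagRes n G) := by
  set g := diagRes n G with hg
  obtain ⟨b, hb, hsum⟩ := eulerDer_vdm_mul_sum fun k => eulerDer k g
  have hsq : ∑ i, eulerDer i (eulerDer i (vdm n)) = (∑ i, (stair n i : ℚ) ^ 2) • vdm n := by
    rw [vdm_eq_alternant, sum_eulerDer_sq_alternant]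
  have e1 : ∑ i, eulerDer i (eulerDer i (vdm n * g)) =
      vdm n * ∑ i, eulerDer i (eulerDer i g) + 2 * ∑ k, eulerDer k (vdm n) * eulerDer k g +
      (∑ i, eulerDer i (eulerDer i (vdm n))) * g := by
    simp only [Derivation.leibniz, map_add, smul_eq_mul, Finset.mul_sum, Finset.sum_mul,
      ← Finset.sum_add_distrib]
    exact Finset.sum_congr rfl fun i _ => by ring
  have split (φ : Fin n → Fin n → MvPolynomial (Fin n) ℚ) :
      ∑ i, ∑ j, φ i j = ∑ i, φ i i + ∑ i, ∑ j ∈ Finset.Ioi i, (φ i j + φ j i) := by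
    rw [Finset.sum_sum_Ioi_add_eq_sum_sum_off_diag (fun j i => φ i j), ← Finset.sum_add_distrib]
    exact Finset.sum_congr rfl fun i _ => (Fintype.sum_eq_add_sum_compl i _)
  have e2 : ((n : ℚ) - 1) • ∑ i, eulerDer i g =
      ∑ i, ∑ j ∈ Finset.Ioi i, (eulerDer i g + eulerDer j g) := by
    have := split fun i _ => eulerDer i g
    rw [← sub_eq_iff_eq_add'] at this
    rw [← this]
    simp [smul_eq_C_mul, Finset.mul_sum, sub_mul]
  have e3 : diagRes n (casimir leftDer G) = ∑ i, eulerDer i (eulerDer i g) +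
      ∑ i, ∑ j ∈ Finset.Ioi i, (diagRes n (leftDer i j (leftDer j i G)) +
      diagRes n (leftDer j i (leftDer i j G))) +
      ∑ i, ∑ j ∈ Finset.Ioi i, (eulerDer i g + eulerDer j g) := by
    rw [← e2, casimir_apply, map_add, map_smul]
    simp only [map_sum]
    rw [split]
    simp only [diagRes_leftDer_self, ← hg]
  rw [e1, hsq, hsum, e3, mul_add, mul_add, smul_mul_assoc, add_sub_cancel_right, add_assoc]
  congr 1
  simp only [Finset.mul_sum, ← Finset.sum_add_distrib]
  refine Finset.sum_congr rfl fun i _ => Finset.sum_congr rfl fun j hj => ?_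
  have := hG.diagRes_offDiag i j
  rw [← hg] at this
  rw [hb i j hj]
  linear_combination b i j * this

theorem IsClassFunction.coeff_vdm_mul_diagRes_casimirSub {G : MvPolynomial (Fin n × Fin n) ℚ}
    (hG : IsClassFunction G) (t : ℚ) (ν : Fin n →₀ ℕ) :
    coeff ν (vdm n * diagRes n (casimirSub leftDer (t - ∑ i, (stair n i : ℚ) ^ 2) G)) =
      ((∑ i, (ν i : ℚ) ^ 2) - t) * coeff ν (vdm n * diagRes n G) := by
  simp only [casimirSub, LinearMap.sub_apply, LinearMap.smul_apply, LinearMap.id_apply, map_sub,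
    map_smul, mul_sub, hG.vdm_mul_diagRes_casimir, mul_smul_comm, coeff_sub, coeff_smul, coeff_sum,
    coeff_eulerDer, smul_eq_mul, Finset.sum_mul]
  simp only [← mul_assoc, ← Finset.sum_mul, ← sq]
  ring

theorem coeff_prod_geometric (m : ℕ) :
    PowerSeries.coeff m (∏ l : Fin n, PowerSeries.mk fun k => (X l : MvPolynomial (Fin n) ℚ) ^ k) =
      hsymm (Fin n) ℚ m := by
  classical
  rw [PowerSeries.coeff_prod, hsymm]
  symm
  refine Finset.sum_bij' (fun s _ => Multiset.toFinsupp s.1)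
    (fun κ hκ => ⟨Finsupp.toMultiset κ, ?_⟩) ?_ ?_ ?_ ?_ ?_
  · rw [Finset.mem_finsuppAntidiag] at hκ
    rw [Finsupp.card_toMultiset, ← hκ.1, Finsupp.sum_fintype _ _ (by simp)]
    rfl
  · intro s _
    rw [Finset.mem_finsuppAntidiag]
    refine ⟨?_, Finset.subset_univ _⟩
    change ∑ i, Multiset.toFinsupp s.1 i = m
    simp only [Multiset.toFinsupp_apply]
    exact (Multiset.sum_count_eq_card fun a _ => Finset.mem_univ a).trans s.2
  · exact fun κ _ => Finset.mem_univ _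
  · intro s _
    exact Subtype.ext (by simp)
  · intro κ _
    simp
  · intro s _
    simp only [PowerSeries.coeff_mk, Multiset.toFinsupp_apply]
    rw [Finset.prod_multiset_map_count]
    refine Finset.prod_subset (Finset.subset_univ _) fun i _ hi => ?_
    rw [Multiset.count_eq_zero.mpr (by simpa using hi), pow_zero]

theorem geometric_mul_one_sub (a : MvPolynomial (Fin n) ℚ) :
    (PowerSeries.mk fun k => a ^ k) *
      ((1 - Polynomial.C a * Polynomial.X : Polynomial (MvPolynomial (Fin n) ℚ)) :
        PowerSeries (MvPolynomial (Fin n) ℚ)) = 1 := by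
  ext m
  rcases m with _ | m
  · simp
  · simp [mul_sub, mul_comm (PowerSeries.C a), ← mul_assoc, PowerSeries.coeff_succ_mul_X, pow_succ,
      PowerSeries.coeff_one]

/-- The product `∏_{l ≠ k} (1 - x_l t)`. -/
noncomputable def elemProd (k : Fin n) : Polynomial (MvPolynomial (Fin n) ℚ) :=
  ∏ l ∈ Finset.univ.erase k, (1 - Polynomial.C (X l) * Polynomial.X)

theorem natDegree_elemProd_lt (k : Fin n) : (elemProd k).natDegree < n := by
  have h : (elemProd k).natDegree ≤ ∑ l ∈ Finset.univ.erase k, 1 := by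
    refine (Polynomial.natDegree_prod_le _ _).trans (Finset.sum_le_sum fun l _ => ?_)
    exact (Polynomial.natDegree_sub_le _ _).trans
      (max_le (by simp) ((Polynomial.natDegree_C_mul_le _ _).trans Polynomial.natDegree_X_le))
  have := k.pos
  simp at h
  omega

theorem prod_geometric_mul_elemProd (k : Fin n) :
    (∏ l : Fin n, PowerSeries.mk fun m => (X l : MvPolynomial (Fin n) ℚ) ^ m) *
      (elemProd k : PowerSeries (MvPolynomial (Fin n) ℚ)) = PowerSeries.mk fun m => X k ^ m := by
  have h : ((elemProd k : Polynomial (MvPolynomial (Fin n) ℚ)) :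
      PowerSeries (MvPolynomial (Fin n) ℚ)) = ∏ l ∈ Finset.univ.erase k,
        ((1 - Polynomial.C (X l) * Polynomial.X : Polynomial (MvPolynomial (Fin n) ℚ)) :
          PowerSeries (MvPolynomial (Fin n) ℚ)) :=
    map_prod Polynomial.coeToPowerSeries.ringHom
      (fun l => 1 - Polynomial.C (X l) * Polynomial.X) (Finset.univ.erase k)
  rw [← Finset.mul_prod_erase _ _ (Finset.mem_univ k), h, mul_assoc, ← Finset.prod_mul_distrib,
    Finset.prod_congr rfl fun l _ => geometric_mul_one_sub (X l), Finset.prod_const_one, mul_one]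

theorem hInt_matrix_mul (lam : Fin n → ℕ) :
    (Matrix.of fun i j : Fin n => hInt n ((lam i : ℤ) - (i : ℤ) + (j : ℤ))) *
      (Matrix.of fun j k : Fin n => (elemProd k).coeff (stair n j)) =
    Matrix.of fun i k : Fin n => (X k : MvPolynomial (Fin n) ℚ) ^ (lam i + stair n i) := by
  ext i k : 1
  have h := congrArg (PowerSeries.coeff (lam i + stair n i)) (prod_geometric_mul_elemProd k)
  rw [PowerSeries.coeff_mk, mul_comm, PowerSeries.coeff_mul,
    Finset.Nat.sum_antidiagonal_eq_sum_range_succ_mk] at h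
  rw [Matrix.mul_apply, Matrix.of_apply, ← h]
  simp only [Matrix.of_apply, Polynomial.coeff_coe, coeff_prod_geometric]
  have e (s : ℕ) : hInt n ((lam i + stair n i : ℕ) - (s : ℤ)) * (elemProd k).coeff s =
      if s ≤ lam i + stair n i then
        (elemProd k).coeff s * hsymm (Fin n) ℚ (lam i + stair n i - s) else 0 := by
    split_ifs with hs
    · rw [hInt, if_pos (by omega), mul_comm]
      congr 2
      omega
    · rw [hInt, if_neg (by omega), zero_mul]
  calc _ = ∑ j : Fin n, hInt n ((lam i + stair n i : ℕ) - ((j : ℕ) : ℤ)) *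
        (elemProd k).coeff j := by
        rw [← Equiv.sum_comp Fin.revPerm (fun j : Fin n =>
          hInt n ((lam i : ℤ) - (i : ℤ) + (j : ℤ)) * (elemProd k).coeff (stair n j))]
        refine Finset.sum_congr rfl fun j _ => ?_
        have hi := i.2
        have hj := j.2
        have h1 : stair n (Fin.revPerm j) = j := by
          simp only [stair, Fin.revPerm_apply, Fin.val_rev]; omega
        rw [h1]
        congr 2
        simp only [stair, Fin.revPerm_apply, Fin.val_rev]
        omega
    _ = ∑ s ∈ Finset.range n, if s ≤ lam i + stair n i then
        (elemProd k).coeff s * hsymm (Fin n) ℚ (lam i + stair n i - s) else 0 := by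
        rw [← Fin.sum_univ_eq_sum_range (fun s => if s ≤ lam i + stair n i then
          (elemProd k).coeff s * hsymm (Fin n) ℚ (lam i + stair n i - s) else 0)]
        exact Finset.sum_congr rfl fun j _ => e j
    _ = ∑ s ∈ Finset.range (lam i + stair n i).succ,
        (elemProd k).coeff s * hsymm (Fin n) ℚ (lam i + stair n i - s) := by
        rw [← Finset.sum_filter]
        refine Finset.sum_subset_zero_on_sdiff ?_ ?_ fun _ _ => rfl
        · intro s
          simp
        · intro s hs
          simp at hs
          rw [Polynomial.coeff_eq_zero_of_natDegree_lt, zero_mul]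
          exact (natDegree_elemProd_lt k).trans_le (by by_contra hc; omega)

theorem schur_mul_vdm (lam : Fin n → ℕ) :
    schur n lam * vdm n = alternant fun i => lam i + stair n i := by
  have h (lam : Fin n → ℕ) := congrArg Matrix.det (hInt_matrix_mul lam)
  have h0 := h 0
  rw [Matrix.det_mul, Matrix.det_of_isUpperTriangular] at h0
  · simp only [Matrix.of_apply, Pi.zero_apply, Nat.cast_zero, zero_sub, neg_add_cancel, hInt,
      le_refl, if_true, Int.toNat_zero, hsymm_zero, Finset.prod_const_one, one_mul, zero_add] at h0
    rw [vdm_eq_alternant, alternant, ← h0, schur, ← Matrix.det_mul, hInt_matrix_mul, alternant]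
  · intro i j hij
    have : (j : ℕ) < i := hij
    simp only [Matrix.of_apply, hInt, Pi.zero_apply]
    rw [if_neg (by simp; omega)]

theorem HasPosKernel.coeff_diagRes_nonneg {G : MvPolynomial (Fin n × Fin n) ℚ}
    (hG : HasPosKernel G) (κ : Fin n →₀ ℕ) : 0 ≤ coeff κ (diagRes n G) := by
  obtain ⟨ι, _, d, k, hk0, hk⟩ := hG
  let res : MvPolynomial (Fin n × Fin n ⊕ Fin n × Fin n) ℚ →ₐ[ℚ]
      MvPolynomial (Fin n) (MvPolynomial (Fin n) ℚ) :=
    aeval (Sum.elim (fun p => if p.1 = p.2 then X p.1 else 0)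
      fun p => if p.1 = p.2 then C (X p.1) else 0)
  let dup : MvPolynomial (Fin n) ℚ →ₐ[ℚ] MvPolynomial (Fin n) (MvPolynomial (Fin n) ℚ) :=
    aeval fun i => X i * C (X i)
  have h1 : res.comp (kernelHom n) = dup.comp (diagRes n) := by
    ext1 ⟨i, j⟩
    by_cases h : i = j <;> simp [res, dup, kernelHom, diagRes, h]
  have h2 : (res.comp (rename Sum.inl)) =
      (aeval fun i => (X i : MvPolynomial (Fin n) (MvPolynomial (Fin n) ℚ))).comp (diagRes n) := by
    ext1 ⟨i, j⟩
    by_cases h : i = j <;> simp [res, diagRes, h]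
  have h3 : (res.comp (rename Sum.inr)) =
      (aeval fun i => C (X i : MvPolynomial (Fin n) ℚ)).comp (diagRes n) := by
    ext1 ⟨i, j⟩
    by_cases h : i = j <;> simp [res, diagRes, h]
  have e1 (g : MvPolynomial (Fin n) ℚ) : coeff κ (coeff κ (dup g)) = coeff κ g := by
    induction g using MvPolynomial.induction_on' with
    | monomial μ a =>
      have : dup (monomial μ a) = monomial μ (monomial μ a) := by
        simp only [dup, aeval_monomial, mul_pow]
        rw [monomial_eq (a := monomial μ a), monomial_eq (a := a), Finsupp.prod_mul, map_mul,
          Finsupp.prod, Finsupp.prod, Finsupp.prod, map_prod]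
        simp only [map_pow, IsScalarTower.algebraMap_apply ℚ (MvPolynomial (Fin n) ℚ)
          (MvPolynomial (Fin n) (MvPolynomial (Fin n) ℚ)), MvPolynomial.algebraMap_eq]
        ring
      rw [this, coeff_monomial]
      split_ifs with h <;> simp [h]
    | add p q hp hq => simp [hp, hq]
  have e2 (g : MvPolynomial (Fin n) ℚ) :
      aeval (fun i => (X i : MvPolynomial (Fin n) (MvPolynomial (Fin n) ℚ))) g = map C g := by
    induction g using MvPolynomial.induction_on with
    | C a =>
      rw [aeval_C, map_C, IsScalarTower.algebraMap_apply ℚ (MvPolynomial (Fin n) ℚ)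
        (MvPolynomial (Fin n) (MvPolynomial (Fin n) ℚ))]
      rfl
    | add p q hp hq => simp [hp, hq]
    | mul_X p i hp => simp [hp]
  have e3 (g : MvPolynomial (Fin n) ℚ) :
      aeval (fun i => C (X i : MvPolynomial (Fin n) ℚ)) g = (C g : MvPolynomial (Fin n) _) := by
    induction g using MvPolynomial.induction_on with
    | C a =>
      rw [aeval_C, IsScalarTower.algebraMap_apply ℚ (MvPolynomial (Fin n) ℚ)
        (MvPolynomial (Fin n) (MvPolynomial (Fin n) ℚ))]
      rfl
    | add p q hp hq => simp [hp, hq]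
    | mul_X p i hp => simp [hp]
  rw [← e1]
  change 0 ≤ coeff κ (coeff κ ((dup.comp (diagRes n)) G))
  rw [← h1, AlgHom.comp_apply, hk, map_smul, map_sum, coeff_smul, coeff_smul, coeff_sum, coeff_sum]
  refine mul_nonneg hk0 (Finset.sum_nonneg fun c _ => ?_)
  rw [map_mul, ← AlgHom.comp_apply, h2, ← AlgHom.comp_apply res, h3, AlgHom.comp_apply,
    AlgHom.comp_apply, e2, e3, mul_comm, coeff_C_mul, coeff_map, mul_comm, coeff_C_mul]
  exact mul_self_nonneg _

theorem stair_injective : Function.Injective (stair n) := by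
  intro i j h
  have := i.2
  have := j.2
  simp only [stair] at h
  ext
  omega

theorem stair_antitone : Antitone (stair n) := by
  intro i j h
  have : (i : ℕ) ≤ j := h
  simp only [stair]
  omega

theorem eq_of_sum_sq_stair_le {w w' : Equiv.Perm (Fin n)}
    (h : ∑ i, ((stair n (w i) : ℚ) - stair n (w' i)) ^ 2 ≤ 0) : w = w' := by
  have h0 := (Finset.sum_eq_zero_iff_of_nonneg fun i _ => sq_nonneg _).mp
    (le_antisymm h (Finset.sum_nonneg fun i _ => sq_nonneg _))
  ext1 i
  have := h0 i (Finset.mem_univ i)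
  rw [sq_eq_zero_iff, sub_eq_zero, Nat.cast_inj] at this
  exact stair_injective this

theorem coeff_vdm_mul (ν : Fin n → ℕ) (g : MvPolynomial (Fin n) ℚ) (w₀ : Equiv.Perm (Fin n))
    (h₀ : ∀ i, stair n (w₀ i) ≤ ν i)
    (h : ∀ w : Equiv.Perm (Fin n), ∀ κ : Fin n →₀ ℕ, (∀ i, κ i + stair n (w i) = ν i) →
      coeff κ g ≠ 0 → w = w₀) :
    coeff (Finsupp.equivFunOnFinite.symm ν) (vdm n * g) = ((Equiv.Perm.sign w₀ : ℤ) : ℚ) *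
      coeff (Finsupp.equivFunOnFinite.symm (ν - stair n ∘ w₀)) g := by
  rw [vdm_eq_alternant, coeff_alternant_mul, Finset.sum_eq_single w₀, if_pos h₀]
  · intro w _ hw
    split_ifs with hle
    · by_contra hne
      refine hw (h w _ (fun i => ?_) (right_ne_zero_of_mul hne))
      simpa using Nat.sub_add_cancel (hle i)
    · simp
  · simp

theorem sum_sq_le_of_coeff_ne_zero {g : MvPolynomial (Fin n) ℚ} {N : ℚ}
    (hN : ∀ ν : Fin n → ℕ, coeff (Finsupp.equivFunOnFinite.symm ν) (vdm n * g) ≠ 0 →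
      ∑ i, (ν i : ℚ) ^ 2 ≤ N)
    {κ : Fin n →₀ ℕ} (hκ : coeff κ g ≠ 0) (w : Equiv.Perm (Fin n)) :
    ∑ i, ((κ i : ℚ) + stair n (w i)) ^ 2 ≤ N := by
  obtain ⟨⟨κ₀, w₀⟩, hmem, hmax⟩ := Finset.exists_max_image
    (g.support ×ˢ (Finset.univ : Finset (Equiv.Perm (Fin n))))
    (fun p => ∑ i, ((p.1 i : ℚ) + stair n (p.2 i)) ^ 2) ⟨(κ, w), by simpa using hκ⟩
  have hκ₀ : coeff κ₀ g ≠ 0 := by simpa using hmem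
  have hmax' (κ : Fin n →₀ ℕ) (h : coeff κ g ≠ 0) (w : Equiv.Perm (Fin n)) :
      ∑ i, ((κ i : ℚ) + stair n (w i)) ^ 2 ≤ ∑ i, ((κ₀ i : ℚ) + stair n (w₀ i)) ^ 2 :=
    hmax (κ, w) (by simpa using h)
  refine (hmax' κ hκ w).trans ?_
  have := hN (fun i => κ₀ i + stair n (w₀ i)) ?_
  · simpa using this
  rw [coeff_vdm_mul _ g w₀ (fun i => Nat.le_add_left _ _)]
  · have e : (fun i => κ₀ i + stair n (w₀ i)) - stair n ∘ w₀ = κ₀ := by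
      ext i
      simp
    rw [e]
    simpa using hκ₀
  · intro w' κ' hsum hκ'
    apply eq_of_sum_sq_stair_le
    have a1 := hmax' κ₀ hκ₀ w'
    have a2 := hmax' κ' hκ' w₀
    have e (i : Fin n) : (κ' i : ℚ) = κ₀ i + stair n (w₀ i) - stair n (w' i) := by
      have := hsum i
      rw [eq_sub_iff_add_eq]
      exact_mod_cast this
    have key : ∑ i, ((stair n (w' i) : ℚ) - stair n (w₀ i)) ^ 2 * 2 =
        (∑ i, ((κ₀ i : ℚ) + stair n (w' i)) ^ 2 + ∑ i, ((κ' i : ℚ) + stair n (w₀ i)) ^ 2) -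
        2 * ∑ i, ((κ₀ i : ℚ) + stair n (w₀ i)) ^ 2 := by
      rw [← Finset.sum_add_distrib, Finset.mul_sum, ← Finset.sum_sub_distrib]
      refine Finset.sum_congr rfl fun i _ => ?_
      rw [e]
      ring
    rw [← Finset.sum_mul] at key
    linarith

theorem coeff_add_stair_vdm_mul {g : MvPolynomial (Fin n) ℚ} {lam : Fin n → ℕ}
    (hlam : Antitone lam)
    (hN : ∀ ν : Fin n → ℕ, coeff (Finsupp.equivFunOnFinite.symm ν) (vdm n * g) ≠ 0 →
      ∑ i, (ν i : ℚ) ^ 2 ≤ ∑ i, ((lam i : ℚ) + stair n i) ^ 2) :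
    coeff (Finsupp.equivFunOnFinite.symm (lam + stair n)) (vdm n * g) =
      coeff (Finsupp.equivFunOnFinite.symm lam) g := by
  rw [coeff_vdm_mul (lam + stair n) g 1 (fun i => Nat.le_add_left _ _)]
  · simp
  · intro w κ hsum hκ
    apply eq_of_sum_sq_stair_le
    have a1 := sum_sq_le_of_coeff_ne_zero hN hκ 1
    have e (i : Fin n) : (κ i : ℚ) = lam i + stair n i - stair n (w i) := by
      have := hsum i
      rw [eq_sub_iff_add_eq]
      exact_mod_cast this
    have mono : Monovary (fun i => (lam i : ℚ) + stair n i) (fun i => (stair n i : ℚ)) := by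
      refine Antitone.monovary (fun i j h => ?_) fun i j h => ?_
      · exact_mod_cast add_le_add (hlam h) (stair_antitone h)
      · exact_mod_cast stair_antitone h
    have rearr := mono.sum_mul_comp_perm_le_sum_mul (σ := w)
    have key : ∑ i, ((κ i : ℚ) + stair n i) ^ 2 = ∑ i, ((lam i : ℚ) + stair n i) ^ 2 +
        2 * (∑ i, ((lam i : ℚ) + stair n i) * stair n i -
          ∑ i, ((lam i : ℚ) + stair n i) * stair n (w i)) +
        ∑ i, ((stair n (w i) : ℚ) - stair n i) ^ 2 := by
      rw [← Finset.sum_sub_distrib, Finset.mul_sum, ← Finset.sum_add_distrib,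
        ← Finset.sum_add_distrib]
      refine Finset.sum_congr rfl fun i _ => ?_
      rw [e]
      ring
    simp only [Equiv.Perm.coe_one, id] at a1 ⊢
    linarith

theorem IsClassFunction.exists_prod_sq {F : MvPolynomial (Fin n × Fin n) ℚ}
    (hF : IsClassFunction F) (hk : HasPosKernel F) (T : Finset ℚ) :
    ∃ G : MvPolynomial (Fin n × Fin n) ℚ, IsClassFunction G ∧ HasPosKernel G ∧
      ∀ ν, coeff ν (vdm n * diagRes n G) =
        (∏ t ∈ T, ((∑ i, (ν i : ℚ) ^ 2) - t) ^ 2) * coeff ν (vdm n * diagRes n F) := by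
  classical
  induction T using Finset.induction_on with
  | empty => exact ⟨F, hF, hk, by simp⟩
  | insert t T ht ih =>
    obtain ⟨G, hG, hkG, h⟩ := ih
    refine ⟨_, (hG.map_casimirSub (t - ∑ i, (stair n i : ℚ) ^ 2)).map_casimirSub _,
      hkG.map_casimirSub_casimirSub hG (t - ∑ i, (stair n i : ℚ) ^ 2), fun ν => ?_⟩
    rw [(hG.map_casimirSub _).coeff_vdm_mul_diagRes_casimirSub,
      hG.coeff_vdm_mul_diagRes_casimirSub, h, Finset.prod_insert ht]
    ring

theorem IsClassFunction.coeff_vdm_mul_nonneg {F : MvPolynomial (Fin n × Fin n) ℚ}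
    (hF : IsClassFunction F) (hk : HasPosKernel F) {lam : Fin n → ℕ} (hlam : Antitone lam) :
    0 ≤ coeff (Finsupp.equivFunOnFinite.symm (lam + stair n)) (vdm n * diagRes n F) := by
  classical
  set N : ℚ := ∑ i, ((lam i : ℚ) + stair n i) ^ 2 with hNdef
  let T : Finset ℚ := ((vdm n * diagRes n F).support.image fun ν => ∑ i, (ν i : ℚ) ^ 2).erase N
  obtain ⟨G, -, hkG, h⟩ := hF.exists_prod_sq hk T
  have hG := coeff_add_stair_vdm_mul (g := diagRes n G) hlam fun ν hν => by
    rw [h] at hν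
    by_contra! hlt
    refine left_ne_zero_of_mul hν (Finset.prod_eq_zero (i := ∑ i, (ν i : ℚ) ^ 2) ?_ (by simp))
    refine Finset.mem_erase.mpr ⟨hlt.ne', Finset.mem_image.mpr
      ⟨Finsupp.equivFunOnFinite.symm ν, ?_, by simp⟩⟩
    simpa using right_ne_zero_of_mul hν
  rw [h] at hG
  have hpos : 0 < ∏ t ∈ T, ((∑ i, ((Finsupp.equivFunOnFinite.symm (lam + stair n) i : ℕ) : ℚ) ^ 2)
      - t) ^ 2 := by
    refine Finset.prod_pos fun t ht => ?_
    have : t ≠ N := (Finset.mem_erase.mp ht).1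
    have e : ∑ i, ((Finsupp.equivFunOnFinite.symm (lam + stair n) i : ℕ) : ℚ) ^ 2 = N := by
      simp [hNdef]
    rw [e]
    have := sub_ne_zero.mpr this.symm
    positivity
  exact nonneg_of_mul_nonneg_right (hG ▸ hkG.coeff_diagRes_nonneg _) hpos

theorem derivation_det {A m : Type*} [CommRing A] [Algebra ℚ A] [Fintype m] [DecidableEq m]
    (D : Derivation ℚ A A) (M : Matrix m m A) :
    D M.det = (M.adjugate * M.map D).trace := by
  have h (j : m) : (M.adjugate * M.map D) j j = (M.updateCol j fun i => D (M i j)).det := by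
    rw [← Matrix.cramer_apply, Matrix.cramer_eq_adjugate_mulVec]
    rfl
  simp only [Matrix.trace, Matrix.diag, h, Matrix.det_apply, map_sum]
  rw [Finset.sum_comm]
  refine Finset.sum_congr rfl fun w _ => ?_
  rw [← Finset.smul_sum, Units.smul_def, Units.smul_def, map_zsmul, derivation_prod]
  congr 1
  refine Finset.sum_congr rfl fun i _ => ?_
  rw [← Finset.prod_erase_mul _ _ (Finset.mem_univ i)]
  congr 1
  · refine Finset.prod_congr rfl fun j hj => ?_
    rw [Matrix.updateCol_ne (Finset.ne_of_mem_erase hj)]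
  · simp

theorem derivation_det_eq_zero_of_commutator {A m : Type*} [CommRing A] [Algebra ℚ A] [Fintype m]
    [DecidableEq m] (D : Derivation ℚ A A) (M N : Matrix m m A) (h : M.map D = N * M - M * N) :
    D M.det = 0 := by
  rw [derivation_det, h, Matrix.mul_sub, Matrix.trace_sub, ← mul_assoc, ← mul_assoc,
    Matrix.trace_mul_cycle, Matrix.adjugate_mul, Matrix.mul_adjugate, sub_self]

/-- A symmetrized form of the Cauchy–Binet formula. -/
theorem card_factorial_smul_det_mul_transpose {A m c : Type*} [CommRing A] [Fintype m]
    [DecidableEq m] [Fintype c] (M N : Matrix m c A) :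
    (Fintype.card m).factorial • (M * N.transpose).det =
      ∑ f : m → c, (M.submatrix id f).det * (N.submatrix id f).det := by
  classical
  have h1 : (M * N.transpose).det = ∑ f : m → c, (∏ i, M i (f i)) * (N.submatrix id f).det := by
    simp only [← Matrix.det_transpose (N.submatrix _ _), ← Matrix.det_mul_column]
    have e : M * N.transpose = Matrix.of fun i => ∑ j, M i j • N.transpose j := by
      ext i j
      simp [Matrix.mul_apply]
    rw [e]
    exact (Matrix.detRowAlternating (R := A) (n := m)).toMultilinearMap.map_sum
      fun i j => M i j • N.transpose j
  have h2 (τ : Equiv.Perm m) : (M * N.transpose).det = ∑ f : m → c,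
      (Equiv.Perm.sign τ : A) * (∏ i, M i (f (τ i))) * (N.submatrix id f).det := by
    rw [h1, ← (τ.symm.arrowCongr (Equiv.refl c)).sum_comp]
    refine Finset.sum_congr rfl fun f _ => ?_
    have : (N.submatrix id f).submatrix id τ = N.submatrix id (f ∘ τ) := rfl
    have h3 := Matrix.det_permute' τ (N.submatrix id f)
    rw [this] at h3
    have h4 : τ.symm.arrowCongr (Equiv.refl c) f = f ∘ τ := rfl
    rw [h4, h3]
    simp only [Function.comp]
    ring
  rw [← Fintype.card_perm, ← Finset.card_univ, ← Finset.sum_const,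
    Finset.sum_congr rfl fun τ _ => h2 τ, Finset.sum_comm]
  refine Finset.sum_congr rfl fun f _ => ?_
  rw [← Finset.sum_mul, ← Matrix.det_transpose (M.submatrix id f),
    Matrix.det_apply' (M.submatrix id f).transpose]
  rfl

/-- The tensor product of a family of `2 × 2` matrices. -/
def pureTensor (m : Fin n → Matrix Bool Bool ℚ) : Matrix (Fin n → Bool) (Fin n → Bool) ℚ :=
  Matrix.of fun s u => ∏ i, m i (s i) (u i)

theorem pureTensor_mul (m m' : Fin n → Matrix Bool Bool ℚ) :
    pureTensor m * pureTensor m' = pureTensor fun i => m i * m' i := by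
  ext s u
  simp only [pureTensor, Matrix.mul_apply, Matrix.of_apply, Finset.prod_univ_sum,
    Fintype.piFinset_univ, Finset.prod_mul_distrib]

theorem pureTensor_add {m m' m'' : Fin n → Matrix Bool Bool ℚ} (a : Fin n)
    (ha : m a + m' a = m'' a) (h : ∀ i, i ≠ a → m i = m'' i) (h' : ∀ i, i ≠ a → m' i = m'' i) :
    pureTensor m + pureTensor m' = pureTensor m'' := by
  ext s u
  simp only [pureTensor, Matrix.add_apply, Matrix.of_apply]
  simp only [← Finset.prod_erase_mul _ _ (Finset.mem_univ a)]
  rw [← ha, Finset.prod_congr rfl fun i hi => by rw [h i (Finset.ne_of_mem_erase hi)],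
    Finset.prod_congr rfl (fun i hi => by rw [h' i (Finset.ne_of_mem_erase hi)] :
      ∀ i ∈ Finset.univ.erase a, m' i (s i) (u i) = m'' i (s i) (u i)), Matrix.add_apply, mul_add]

theorem pureTensor_eq_zero {m : Fin n → Matrix Bool Bool ℚ} (a : Fin n) (ha : m a = 0) :
    pureTensor m = 0 := by
  ext s u
  exact Finset.prod_eq_zero (Finset.mem_univ a) (by simp [ha])

theorem pureTensor_one : pureTensor (1 : Fin n → Matrix Bool Bool ℚ) = 1 := by
  ext s u
  simp [pureTensor, Matrix.one_apply, Finset.prod_ite_zero, funext_iff]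

/-- The `2 × 2` parity matrix. -/
def parity : Matrix Bool Bool ℚ := Matrix.diagonal fun b => if b then -1 else 1

/-- The Jordan–Wigner string with parity signs before `a` and `x` in position `a`. -/
def jordanWigner (a : Fin n) (x : Matrix Bool Bool ℚ) :
    Matrix (Fin n → Bool) (Fin n → Bool) ℚ :=
  pureTensor fun i => if i < a then parity
    else if i = a then x else 1

theorem jordanWigner_anticomm_of_lt {a b : Fin n} (h : a < b) {x y : Matrix Bool Bool ℚ}
    (hx : x * parity +
      parity * x = 0) :
    jordanWigner a x * jordanWigner b y + jordanWigner b y * jordanWigner a x = 0 := by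
  rw [jordanWigner, jordanWigner, pureTensor_mul, pureTensor_mul,
    pureTensor_add (m'' := fun i => if i = a then 0 else
      (if i < b then parity
        else if i = b then y else 1) *
      (if i < a then parity else 1)) a]
  · exact pureTensor_eq_zero a (by simp)
  · simpa [h] using hx
  · intro i hi
    simp only [hi, if_false]
    split_ifs with h1 h2 <;> first | rfl | simp | omega
  · intro i hi
    simp [hi]

/-- The `2 × 2` raising matrix. -/
def raising : Matrix Bool Bool ℚ := Matrix.single true false 1

theorem raising_anticomm_parity : raising * parity + parity * raising = 0 := by
  ext b c
  cases b <;> cases c <;> simp [raising, parity]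

theorem transpose_raising_anticomm_parity :
    raising.transpose * parity + parity * raising.transpose = 0 := by
  ext b c
  cases b <;> cases c <;> simp [raising, parity]

/-- The fermionic creation matrices. -/
def creation (a : Fin n) : Matrix (Fin n → Bool) (Fin n → Bool) ℚ := jordanWigner a raising

theorem jordanWigner_transpose (a : Fin n) (x : Matrix Bool Bool ℚ) :
    (jordanWigner a x).transpose = jordanWigner a x.transpose := by
  ext s u
  simp only [jordanWigner, pureTensor, Matrix.transpose_apply, Matrix.of_apply]
  refine Finset.prod_congr rfl fun i _ => ?_
  split_ifs
  · cases s i <;> cases u i <;> rfl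
  · rfl
  · simp [Matrix.one_apply, eq_comm]

theorem jordanWigner_self (a : Fin n) {x y z : Matrix Bool Bool ℚ} (h : x * y + y * x = z) :
    jordanWigner a x * jordanWigner a y + jordanWigner a y * jordanWigner a x =
      pureTensor fun i => if i = a then z else 1 := by
  rw [jordanWigner, jordanWigner, pureTensor_mul, pureTensor_mul]
  apply pureTensor_add a
  · simpa using h
  · intro i hi
    simp only [hi, if_false]
    split_ifs
    · ext b c
      cases b <;> cases c <;> simp [parity]
    · simp
  · intro i hi
    simp only [hi, if_false]
    split_ifs
    · ext b c
      cases b <;> cases c <;> simp [parity]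
    · simp

theorem creation_mul_creation (a b : Fin n) :
    creation a * creation b = -(creation b * creation a) := by
  rw [← add_eq_zero_iff_eq_neg]
  rcases lt_trichotomy a b with hab | rfl | hab
  · exact jordanWigner_anticomm_of_lt hab raising_anticomm_parity
  · rw [creation, jordanWigner_self a (z := 0) (by simp [raising])]
    exact pureTensor_eq_zero a (by simp)
  · rw [add_comm]
    exact jordanWigner_anticomm_of_lt hab raising_anticomm_parity

theorem transpose_creation_mul_creation (a b : Fin n) :
    (creation a).transpose * creation b =
      (if a = b then 1 else 0) - creation b * (creation a).transpose := by
  rw [eq_sub_iff_add_eq, creation, jordanWigner_transpose]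
  rcases lt_trichotomy a b with hab | rfl | hab
  · rw [if_neg hab.ne]
    exact jordanWigner_anticomm_of_lt hab transpose_raising_anticomm_parity
  · rw [if_pos rfl, creation, jordanWigner_self a (z := 1), ← pureTensor_one]
    · congr 1
      ext i
      simp
    · ext b c
      cases b <;> cases c <;> simp [raising]
  · rw [if_neg hab.ne', add_comm]
    exact jordanWigner_anticomm_of_lt hab raising_anticomm_parity

/-- The action of the matrix unit `E_{ab}` of `gl_n` on the exterior algebra. -/
def fermionUnit (a b : Fin n) : Matrix (Fin n → Bool) (Fin n → Bool) ℚ :=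
  creation a * (creation b).transpose

theorem fermionUnit_commutator (i j k l : Fin n) :
    fermionUnit i j * fermionUnit k l - fermionUnit k l * fermionUnit i j =
      (if j = k then fermionUnit i l else 0) - (if l = i then fermionUnit k j else 0) := by
  have h1 : creation i * (creation j).transpose * (creation k * (creation l).transpose) =
      creation i * ((creation j).transpose * creation k) * (creation l).transpose := by
    simp only [mul_assoc]
  have h2 : creation k * (creation l).transpose * (creation i * (creation j).transpose) =
      creation k * ((creation l).transpose * creation i) * (creation j).transpose := by
    simp only [mul_assoc]
  have h3 : creation i * (creation k * (creation j).transpose) * (creation l).transpose =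
      creation k * (creation i * (creation l).transpose) * (creation j).transpose := by
    have e1 := creation_mul_creation i k
    have e2 : (creation j).transpose * (creation l).transpose =
        -((creation l).transpose * (creation j).transpose) := by
      rw [← Matrix.transpose_mul, creation_mul_creation, Matrix.transpose_neg,
        Matrix.transpose_mul]
    calc _ = (creation i * creation k) * ((creation j).transpose * (creation l).transpose) := by
          simp only [mul_assoc]
      _ = _ := by
          rw [e1, e2]
          simp only [neg_mul_neg, mul_assoc]
  simp only [fermionUnit]
  rw [h1, h2, transpose_creation_mul_creation, transpose_creation_mul_creation, mul_sub, mul_sub,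
    sub_mul, sub_mul, h3, sub_sub_sub_cancel_right]
  split_ifs <;> simp

theorem creation_apply_false (a : Fin n) (u : Fin n → Bool) : creation a (fun _ => false) u = 0 :=
  Finset.prod_eq_zero (Finset.mem_univ a) (by simp [raising])

theorem fermionUnit_self (a : Fin n) :
    fermionUnit a a = Matrix.diagonal fun s => if s a then 1 else 0 := by
  rw [fermionUnit, creation, jordanWigner_transpose, jordanWigner, jordanWigner, pureTensor_mul]
  ext s u
  simp only [pureTensor, Matrix.of_apply, Matrix.diagonal_apply]
  have h (i : Fin n) (b c : Bool) : ((if i < a then parity else if i = a then raising else 1) *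
      (if i < a then parity else if i = a then raising.transpose else 1) :
        Matrix Bool Bool ℚ) b c =
      if b = c then (if i = a then (if b then 1 else 0) else 1) else 0 := by
    split_ifs <;> (try omega) <;> cases b <;> cases c <;>
      simp_all [raising, parity, Matrix.mul_apply, Matrix.single_apply]
  simp only [h, Finset.prod_ite_zero, funext_iff, Finset.mem_univ, true_imp_iff,
    Finset.prod_ite_eq']
  simp

/-- The action of the matrix `y` on the exterior algebra by derivations, made to fix the vacuum. -/
noncomputable def fermionMatrix {A : Type*} [CommRing A] [Algebra ℚ A] (y : Fin n × Fin n → A) :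
    Matrix (Fin n → Bool) (Fin n → Bool) A :=
  Matrix.single (fun _ => false) (fun _ => false) 1 +
    ∑ a, ∑ b, y (a, b) • (fermionUnit a b).map (algebraMap ℚ A)

theorem fermionMatrix_map {A B : Type*} [CommRing A] [Algebra ℚ A] [CommRing B] [Algebra ℚ B]
    (φ : A →ₐ[ℚ] B) (y : Fin n × Fin n → A) :
    (fermionMatrix y).map φ = fermionMatrix (φ ∘ y) := by
  ext s u
  simp [fermionMatrix, Matrix.sum_apply, Matrix.single_apply, apply_ite φ]

theorem fermionUnit_mul_single (a b : Fin n) :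
    fermionUnit a b * Matrix.single (fun _ => false) (fun _ => false) 1 = 0 := by
  ext s u
  by_cases h : u = fun _ => false
  · subst h
    rw [Matrix.mul_single_apply_same]
    simp [fermionUnit, Matrix.mul_apply, creation_apply_false]
  · rw [Matrix.mul_single_apply_of_ne _ _ _ _ _ h, Matrix.zero_apply]

theorem single_mul_fermionUnit (a b : Fin n) :
    Matrix.single (fun _ => false) (fun _ => false) 1 * fermionUnit a b = 0 := by
  have := congrArg Matrix.transpose (fermionUnit_mul_single b a)
  simpa [fermionUnit, Matrix.transpose_mul] using this

/-- The determinant of the action of a generic matrix on the exterior algebra modulo constants. -/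
noncomputable def fermionDet (n : ℕ) : MvPolynomial (Fin n × Fin n) ℚ :=
  (fermionMatrix (n := n) X).det

theorem map_fermionDet {A : Type*} [CommRing A] [Algebra ℚ A]
    (φ : MvPolynomial (Fin n × Fin n) ℚ →ₐ[ℚ] A) :
    φ (fermionDet n) = (fermionMatrix fun p => φ (X p)).det := by
  rw [fermionDet, AlgHom.map_det]
  exact congrArg Matrix.det (fermionMatrix_map φ X)

theorem fermionMatrix_map_derivation (D : Derivation ℚ (MvPolynomial (Fin n × Fin n) ℚ)
    (MvPolynomial (Fin n × Fin n) ℚ)) :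
    (fermionMatrix (n := n) X).map D = ∑ a, ∑ b, D (X (a, b)) •
      (fermionUnit a b).map (algebraMap ℚ (MvPolynomial (Fin n × Fin n) ℚ)) := by
  ext1 s u
  simp only [fermionMatrix, Matrix.map_apply, Matrix.add_apply, Matrix.sum_apply,
    Matrix.smul_apply, map_add, map_sum, smul_eq_mul, Derivation.leibniz,
    Derivation.map_algebraMap, mul_zero, zero_add, Matrix.single_apply, apply_ite D, map_zero,
    Derivation.map_one_eq_zero, ite_self]
  exact Finset.sum_congr rfl fun a _ => Finset.sum_congr rfl fun b _ => mul_comm _ _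

theorem isClassFunction_fermionDet : IsClassFunction (fermionDet n) := by
  intro i j
  rw [← sub_eq_zero]
  refine derivation_det_eq_zero_of_commutator (leftDer i j - rightDer j i) _
    ((fermionUnit j i).map (algebraMap ℚ _)) ?_
  set ι := algebraMap ℚ (MvPolynomial (Fin n × Fin n) ℚ) with hι
  have h0 : (Matrix.single (fun _ : Fin n => false) (fun _ : Fin n => false)
      (1 : MvPolynomial (Fin n × Fin n) ℚ)) =
      (Matrix.single (fun _ => false) (fun _ => false) 1).map ι := by
    simp
  have h1 (a b : Fin n) : (fermionUnit j i).map ι * ((X (a, b) : MvPolynomial _ ℚ) •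
      (fermionUnit a b).map ι) -
      ((X (a, b) : MvPolynomial _ ℚ) • (fermionUnit a b).map ι) * (fermionUnit j i).map ι =
      (if i = a then (X (i, b) : MvPolynomial _ ℚ) • (fermionUnit j b).map ι else 0) -
      (if j = b then (X (a, j) : MvPolynomial _ ℚ) • (fermionUnit a i).map ι else 0) := by
    rw [mul_smul_comm, smul_mul_assoc, ← smul_sub, ← Matrix.map_mul, ← Matrix.map_mul,
      ← Matrix.map_sub _ (map_sub _), fermionUnit_commutator, Matrix.map_sub _ (map_sub _),
      smul_sub]
    simp only [eq_comm (a := j)]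
    congr 1 <;> split_ifs with h <;> simp [h]
  rw [fermionMatrix_map_derivation, fermionMatrix, mul_add, add_mul, h0, ← Matrix.map_mul,
    ← Matrix.map_mul, fermionUnit_mul_single, single_mul_fermionUnit]
  simp only [Matrix.map_zero, map_zero, zero_add, Finset.mul_sum, Finset.sum_mul,
    ← Finset.sum_sub_distrib, ← hι, h1, Derivation.sub_apply, leftDer_X, rightDer_X, sub_smul,
    ite_smul, zero_smul]
  simp only [Finset.sum_sub_distrib, Finset.sum_ite_irrel, Finset.sum_ite_eq, Finset.mem_univ,
    if_true, Finset.sum_const_zero]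

/-- A rectangular matrix whose Gram matrix is `fermionMatrix`. -/
noncomputable def fermionFactor {A : Type*} [CommRing A] [Algebra ℚ A] (y : Fin n × Fin n → A) :
    Matrix (Fin n → Bool) (Option ((Fin n → Bool) × Fin n)) A :=
  Matrix.of fun s o => o.elim (if s = fun _ => false then 1 else 0)
    fun p => ∑ a, algebraMap ℚ A (creation a s p.1) * y (a, p.2)

theorem fermionFactor_map {A B : Type*} [CommRing A] [Algebra ℚ A] [CommRing B] [Algebra ℚ B]
    (φ : A →ₐ[ℚ] B) (y : Fin n × Fin n → A) :
    (fermionFactor y).map φ = fermionFactor (φ ∘ y) := by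
  ext s (_ | p) <;> simp [fermionFactor, apply_ite φ]

theorem fermionFactor_mul_transpose {A : Type*} [CommRing A] [Algebra ℚ A]
    (y z : Fin n × Fin n → A) : fermionFactor y * (fermionFactor z).transpose =
      fermionMatrix fun p => ∑ k, y (p.1, k) * z (p.2, k) := by
  ext1 s u
  rw [Matrix.mul_apply, Fintype.sum_option, fermionMatrix, Matrix.add_apply]
  congr 1
  · rw [Matrix.single_apply]
    by_cases h : s = fun _ => false <;> by_cases h' : u = fun _ => false <;>
      simp [fermionFactor, h, h', eq_comm]
  · simp only [fermionFactor, fermionUnit, Matrix.transpose_apply, Matrix.of_apply,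
      Option.elim_some, Matrix.sum_apply, Matrix.smul_apply, Matrix.map_apply, Matrix.mul_apply,
      smul_eq_mul, map_sum, map_mul]
    simp only [Finset.sum_mul_sum (κ := Fin n) (ι := Fin n) _ _
      (fun a => algebraMap ℚ A (creation a s _) * _)]
    rw [Finset.sum_comm]
    refine Finset.sum_congr rfl fun a _ => ?_
    rw [Finset.sum_comm]
    refine Finset.sum_congr rfl fun b _ => ?_
    rw [Finset.sum_mul_sum, Fintype.sum_prod_type_right]
    exact Finset.sum_congr rfl fun k _ => Finset.sum_congr rfl fun t _ => by ring

theorem hasPosKernel_fermionDet : HasPosKernel (fermionDet n) := by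
  refine ⟨(Fin n → Bool) → Option ((Fin n → Bool) × Fin n), inferInstance,
    fun f => ((fermionFactor X).submatrix id f).det,
    ((Fintype.card (Fin n → Bool)).factorial : ℚ)⁻¹, by positivity, ?_⟩
  have h := card_factorial_smul_det_mul_transpose
    (fermionFactor fun p => (X (Sum.inl p) : MvPolynomial (Fin n × Fin n ⊕ Fin n × Fin n) ℚ))
    (fermionFactor fun p => X (Sum.inr p))
  rw [fermionFactor_mul_transpose] at h
  have h2 : kernelHom n (fermionDet n) = (fermionMatrix fun p : Fin n × Fin n => ∑ k,
      (X (Sum.inl (p.1, k)) * X (Sum.inr (p.2, k)) :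
        MvPolynomial (Fin n × Fin n ⊕ Fin n × Fin n) ℚ)).det := by
    simp only [map_fermionDet, kernelHom, aeval_X]
  rw [eq_inv_smul_iff₀ (by positivity), Nat.cast_smul_eq_nsmul, h2, h]
  refine Finset.sum_congr rfl fun f _ => ?_
  rw [AlgHom.map_det, AlgHom.map_det, AlgHom.mapMatrix_apply, AlgHom.mapMatrix_apply,
    ← Matrix.submatrix_map, ← Matrix.submatrix_map, fermionFactor_map, fermionFactor_map]
  simp only [Function.comp_def, rename_X]

theorem totalBooleanProd_eq_prod_erase :
    totalBooleanProd n = ∏ S ∈ Finset.univ.erase ∅, ∑ i ∈ S, X i := by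
  rw [totalBooleanProd, ← Finset.prod_fiberwise_of_maps_to (t := Finset.Icc 1 n) (g := Finset.card)]
  · refine Finset.prod_congr rfl fun k hk => Finset.prod_congr ?_ fun _ _ => rfl
    ext S
    have := (Finset.mem_Icc.mp hk).1
    simp only [Finset.mem_powersetCard, Finset.subset_univ, true_and, Finset.mem_filter,
      Finset.mem_erase, Finset.mem_univ, and_true]
    refine ⟨fun h => ⟨?_, h⟩, And.right⟩
    rintro rfl
    simp at h
    omega
  · intro S hS
    simpa [Finset.one_le_card, Finset.nonempty_iff_ne_empty] using
      ⟨Finset.ne_of_mem_erase hS, card_finset_fin_le S⟩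

theorem diagRes_fermionDet : diagRes n (fermionDet n) = totalBooleanProd n := by
  have h : (fermionMatrix fun p => diagRes n (X p)) = Matrix.diagonal fun s =>
      if s = fun _ => false then 1 else ∑ i, if s i then X i else 0 := by
    ext1 s u
    simp only [diagRes_X, fermionMatrix, ite_smul, zero_smul, Finset.sum_ite_eq, Finset.mem_univ,
      if_true, fermionUnit_self, Matrix.add_apply, Matrix.sum_apply, Matrix.smul_apply,
      Matrix.map_apply, Matrix.diagonal_apply, Matrix.single_apply]
    by_cases h : s = u
    · subst h
      by_cases h0 : s = fun _ => false
      · subst h0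
        simp
      · simp [h0, Ne.symm h0]
    · have : ¬ ((fun _ => false) = s ∧ (fun _ => false) = u) := fun h' => h (h'.1.symm.trans h'.2)
      simp [h, this]
  rw [map_fermionDet, h, Matrix.det_diagonal]
  let e : (Fin n → Bool) ≃ Finset (Fin n) :=
    { toFun s := Finset.univ.filter fun i => s i
      invFun S i := decide (i ∈ S)
      left_inv s := by simp
      right_inv S := by simp }
  rw [totalBooleanProd_eq_prod_erase,
    ← Finset.prod_erase Finset.univ (a := fun _ => false) (by simp)]
  refine Finset.prod_equiv e (fun s => ?_) fun s hs => ?_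
  · simp [e, Finset.filter_eq_empty_iff, funext_iff]
  · rw [if_neg (Finset.ne_of_mem_erase hs), ← Finset.sum_filter]
    rfl

/-- Antisymmetry under permutations of the variables. -/
def IsAntisymmetric (p : MvPolynomial (Fin n) ℚ) : Prop :=
  ∀ w : Equiv.Perm (Fin n), rename w p = ((Equiv.Perm.sign w : ℤ) : ℚ) • p

theorem isAntisymmetric_alternant (α : Fin n → ℕ) : IsAntisymmetric (alternant α) := by
  intro w
  have := Matrix.det_permute' w (Matrix.of fun i j : Fin n => (X j : MvPolynomial (Fin n) ℚ) ^ α i)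
  rw [alternant, AlgHom.map_det, smul_eq_C_mul]
  convert this using 2
  · ext1 i j
    simp
  · simp

theorem IsAntisymmetric.sub {p q : MvPolynomial (Fin n) ℚ} (hp : IsAntisymmetric p)
    (hq : IsAntisymmetric q) : IsAntisymmetric (p - q) := fun w => by
  rw [map_sub, hp, hq, smul_sub]

theorem IsAntisymmetric.sum_smul {ι : Type*} {s : Finset ι} {c : ι → ℚ}
    {p : ι → MvPolynomial (Fin n) ℚ} (hp : ∀ i ∈ s, IsAntisymmetric (p i)) :
    IsAntisymmetric (∑ i ∈ s, c i • p i) := fun w => by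
  rw [map_sum, Finset.smul_sum]
  refine Finset.sum_congr rfl fun i hi => ?_
  rw [map_smul, hp i hi, smul_comm]

theorem IsAntisymmetric.mul_isSymmetric {p q : MvPolynomial (Fin n) ℚ} (hp : IsAntisymmetric p)
    (hq : q.IsSymmetric) : IsAntisymmetric (p * q) := fun w => by
  rw [map_mul, hp, hq, smul_mul_assoc]

theorem IsAntisymmetric.coeff_comp {p : MvPolynomial (Fin n) ℚ} (hp : IsAntisymmetric p)
    (ν : Fin n → ℕ) (w : Equiv.Perm (Fin n)) :
    coeff (Finsupp.equivFunOnFinite.symm (ν ∘ w)) p =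
      ((Equiv.Perm.sign w : ℤ) : ℚ) * coeff (Finsupp.equivFunOnFinite.symm ν) p := by
  rw [← coeff_rename_mapDomain w w.injective, hp w, coeff_smul, smul_eq_mul]
  congr 2
  ext i
  rw [Finsupp.mapDomain_equiv_apply]
  simp

theorem IsAntisymmetric.eq_zero {p : MvPolynomial (Fin n) ℚ} (hp : IsAntisymmetric p)
    (h : ∀ ν : Fin n → ℕ, StrictAnti ν → coeff (Finsupp.equivFunOnFinite.symm ν) p = 0) :
    p = 0 := by
  ext κ
  obtain ⟨ν, rfl⟩ := Finsupp.equivFunOnFinite.symm.surjective κ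
  rw [coeff_zero]
  by_cases hν : Function.Injective ν
  · let w := Tuple.sort (OrderDual.toDual ∘ ν)
    have hw : Antitone (ν ∘ w) := Tuple.monotone_sort (OrderDual.toDual ∘ ν)
    have := hp.coeff_comp ν w
    rw [h _ (hw.strictAnti_of_injective (hν.comp w.injective))] at this
    rcases Int.units_eq_one_or (Equiv.Perm.sign w) with e | e <;> simpa [e] using this.symm
  · simp only [Function.Injective, not_forall] at hν
    obtain ⟨i, j, hij, hne⟩ := hν
    have := hp.coeff_comp ν (Equiv.swap i j)
    have e : ν ∘ Equiv.swap i j = ν := by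
      ext k
      simp only [Function.comp, Equiv.swap_apply_def]
      split_ifs <;> simp_all
    rw [e, Equiv.Perm.sign_swap hne] at this
    push_cast at this
    linarith

theorem strictAnti_add_stair {lam : Fin n → ℕ} (h : Antitone lam) : StrictAnti (lam + stair n) :=
  h.add_strictAnti (stair_antitone.strictAnti_of_injective stair_injective)

theorem StrictAnti.exists_add_stair {ν : Fin n → ℕ} (h : StrictAnti ν) :
    ∃ lam : Fin n → ℕ, Antitone lam ∧ ν = lam + stair n := by
  have key (k : ℕ) (i j : Fin n) (hij : (j : ℕ) = i + k) : ν j + k ≤ ν i := by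
    induction k generalizing j with
    | zero => simp [Fin.ext hij]
    | succ k ih =>
      have hj := j.2
      have h1 := ih ⟨i + k, by omega⟩ rfl
      have h2 : ν j < ν ⟨i + k, by omega⟩ := h (Fin.lt_def.mpr (by simp; omega))
      omega
  have hle (i : Fin n) : stair n i ≤ ν i := by
    have := key (n - 1 - i) i ⟨n - 1, by have := i.2; omega⟩ (by have := i.2; simp; omega)
    simp only [stair]
    omega
  refine ⟨ν - stair n, fun i j hij => ?_, funext fun i => (Nat.sub_add_cancel (hle i)).symm⟩
  have h1 : (i : ℕ) ≤ j := hij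
  have := key (j - i) i j (by omega)
  have := j.2
  simp only [Pi.sub_apply, stair]
  omega

theorem coeff_alternant_of_strictAnti {α ν : Fin n → ℕ} (hα : StrictAnti α) (hν : StrictAnti ν) :
    coeff (Finsupp.equivFunOnFinite.symm ν) (alternant α) = if α = ν then 1 else 0 := by
  rw [alternant_eq_sum, coeff_sum, Finset.sum_eq_single 1]
  · simp [coeff_monomial]
  · intro w _ hw
    rw [coeff_smul, coeff_monomial, if_neg, smul_zero]
    intro h
    have h' : α ∘ w = ν := Finsupp.equivFunOnFinite.symm.injective h
    have hmono : StrictMono w := fun i j hij => hα.lt_iff_gt.mp (by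
      have := hν hij
      rwa [← h'] at this)
    exact hw (Equiv.coe_fn_injective ((hmono.range_inj strictMono_id).mp (by simp)))
  · simp

theorem vdm_ne_zero : vdm n ≠ 0 := by
  refine Finset.prod_ne_zero_iff.mpr fun i _ => Finset.prod_ne_zero_iff.mpr fun j hj => ?_
  exact sub_ne_zero.mpr fun h => (Finset.mem_Ioi.mp hj).ne (X_injective h)

theorem isHomogeneous_vdm : (vdm n).IsHomogeneous (∑ i, stair n i) := by
  refine IsHomogeneous.prod _ _ _ fun i _ => ?_
  have := IsHomogeneous.prod (Finset.Ioi i) (fun j => (X i - X j : MvPolynomial (Fin n) ℚ))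
    (fun _ => 1) fun j _ => (isHomogeneous_X _ _).sub (isHomogeneous_X _ _)
  simpa [stair, Fin.card_Ioi] using this

theorem isHomogeneous_totalBooleanProd : (totalBooleanProd n).IsHomogeneous (2 ^ n - 1) := by
  rw [totalBooleanProd_eq_prod_erase]
  have := IsHomogeneous.prod (Finset.univ.erase (∅ : Finset (Fin n)))
    (fun S => (∑ i ∈ S, X i : MvPolynomial (Fin n) ℚ)) (fun _ => 1)
    fun S _ => IsHomogeneous.sum _ _ _ fun i _ => isHomogeneous_X _ _
  simpa using this

theorem isSymmetric_totalBooleanProd : (totalBooleanProd n).IsSymmetric := by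
  intro w
  rw [totalBooleanProd_eq_prod_erase, map_prod]
  refine Finset.prod_equiv w.finsetCongr (by simp) fun S _ => ?_
  simp [Finset.sum_map]

theorem exists_map_eq_vdm_mul_totalBooleanProd :
    ∃ q : MvPolynomial (Fin n) ℤ, map (Int.castRingHom ℚ) q = vdm n * totalBooleanProd n := by
  refine ⟨(∏ i : Fin n, ∏ j ∈ Finset.Ioi i, (X i - X j)) *
    ∏ S ∈ Finset.univ.erase ∅, ∑ i ∈ S, X i, ?_⟩
  simp [vdm, totalBooleanProd_eq_prod_erase, map_prod, map_sum]

theorem coeff_vdm_mul_totalBooleanProd_nonneg {lam : Fin n → ℕ} (hlam : Antitone lam) :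
    0 ≤ coeff (Finsupp.equivFunOnFinite.symm (lam + stair n)) (vdm n * totalBooleanProd n) := by
  rw [← diagRes_fermionDet]
  exact isClassFunction_fermionDet.coeff_vdm_mul_nonneg hasPosKernel_fermionDet hlam

theorem stmt1 (n : ℕ) :
    ∃ (P : Finset (Fin n → ℕ)) (c : (Fin n → ℕ) → ℕ),
      (∀ lam ∈ P, Antitone lam ∧ ∑ i, lam i = 2 ^ n - 1) ∧
      totalBooleanProd n = ∑ lam ∈ P, (c lam : MvPolynomial (Fin n) ℚ) * schur n lam := by
  classical
  obtain ⟨q, hq⟩ := exists_map_eq_vdm_mul_totalBooleanProd (n := n)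
  set A := vdm n * totalBooleanProd n with hA
  let P : Finset (Fin n → ℕ) := (Fintype.piFinset fun _ => Finset.range (2 ^ n - 1 + 1)).filter
    fun lam => Antitone lam ∧ ∑ i, lam i = 2 ^ n - 1
  let c : (Fin n → ℕ) → ℕ := fun lam =>
    (coeff (Finsupp.equivFunOnFinite.symm (lam + stair n)) q).toNat
  have hP (lam : Fin n → ℕ) : lam ∈ P ↔ Antitone lam ∧ ∑ i, lam i = 2 ^ n - 1 := by
    simp only [P, Finset.mem_filter, Fintype.mem_piFinset, Finset.mem_range, Order.lt_add_one_iff,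
      and_iff_right_iff_imp]
    rintro ⟨-, h⟩ i
    exact h ▸ Finset.single_le_sum (fun _ _ => Nat.zero_le _) (Finset.mem_univ i)
  have hc {lam : Fin n → ℕ} (hlam : Antitone lam) :
      (c lam : ℚ) = coeff (Finsupp.equivFunOnFinite.symm (lam + stair n)) A := by
    have h0 := coeff_vdm_mul_totalBooleanProd_nonneg hlam
    rw [← hA, ← hq, coeff_map] at h0
    rw [← hq, coeff_map]
    have h1 : 0 ≤ coeff (Finsupp.equivFunOnFinite.symm (lam + stair n)) q := by simpa using h0
    have := Int.toNat_of_nonneg h1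
    rw [eq_intCast, ← this]
    rfl
  have hanti : IsAntisymmetric A := by
    rw [hA, vdm_eq_alternant]
    exact (isAntisymmetric_alternant _).mul_isSymmetric isSymmetric_totalBooleanProd
  have hexp : A - ∑ lam ∈ P, (c lam : ℚ) • alternant (lam + stair n) = 0 := by
    refine (hanti.sub (IsAntisymmetric.sum_smul fun _ _ =>
      isAntisymmetric_alternant _)).eq_zero fun ν hν => ?_
    obtain ⟨lam, hlam, rfl⟩ := hν.exists_add_stair
    have h1 (μ : Fin n → ℕ) (hμ : μ ∈ P) : coeff (Finsupp.equivFunOnFinite.symm (lam + stair n))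
        ((c μ : ℚ) • alternant (μ + stair n)) = if lam = μ then (c lam : ℚ) else 0 := by
      rw [coeff_smul, coeff_alternant_of_strictAnti (strictAnti_add_stair ((hP μ).mp hμ).1) hν]
      by_cases h : lam = μ <;> simp [h, Ne.symm]
    rw [coeff_sub, coeff_sum, Finset.sum_congr rfl h1, Finset.sum_ite_eq]
    split_ifs with h
    · rw [hc hlam, sub_self]
    · rw [sub_zero]
      by_contra hne
      have := (isHomogeneous_vdm.mul isHomogeneous_totalBooleanProd) hne
      refine h ((hP lam).mpr ⟨hlam, ?_⟩)
      rw [Finsupp.weight_apply, Finsupp.sum_fintype _ _ (by simp)] at this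
      simp only [Finsupp.equivFunOnFinite_symm_apply_apply, Pi.add_apply, Pi.one_apply,
        smul_eq_mul, mul_one, Finset.sum_add_distrib] at this
      omega
  refine ⟨P, c, fun lam h => (hP lam).mp h, mul_left_cancel₀ (vdm_ne_zero (n := n)) ?_⟩
  rw [← hA, sub_eq_zero.mp hexp, Finset.mul_sum]
  refine Finset.sum_congr rfl fun lam _ => ?_
  rw [smul_eq_C_mul, map_natCast, mul_left_comm, mul_comm (vdm n), schur_mul_vdm]
  rfl
end
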